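/- arXiv:2604.14076 — 2 statements merged into one kernel-verified Lean document; each statement's English description precedes it below -/
import Mathlib

section
/- Let ℓ ≥ 1 and fix bounded large initial conditions: u_i^0 ≥ 0 for i > ℓ with ∑_{i>ℓ} u_i^0 = 1, and u_i^0 = 0 for all i > L for some integer L ≥ ℓ+1. Then there exists T > 0 such that on [0,T] there is exactly one large-cluster solution of the large-cluster system with these initial conditions that is also a pre-gelation solution; moreover every cluster fraction u_i of this solution belongs to C^∞([0,T],[0,1]). -/
open Finset Filter Topology

noncomputable section

/-- Total particle number for large clusters `m₁(t) = ∑_{i > ℓ} i u_i(t)`. -/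
def m1large (ℓ : ℕ) (u : ℕ → ℝ → ℝ) (t : ℝ) : ℝ :=
  ∑' i : ℕ, if ℓ + 1 ≤ i then (i : ℝ) * u i t else 0

/-- Right-hand side of the large-cluster equation for `u n` (`n > ℓ`):
`(1/m₁²) ∑_{i=ℓ+1}^{n−1} i(n+ℓ−i) u_i u_{n+ℓ−i} − 2 n u_n/m₁`
(the sum is empty when `n = ℓ+1`). -/
def largeRHS (ℓ : ℕ) (u : ℕ → ℝ → ℝ) (n : ℕ) (t : ℝ) : ℝ :=
  (1 / (m1large ℓ u t) ^ 2) *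
      (∑ i ∈ Finset.Icc (ℓ + 1) (n - 1),
        (i : ℝ) * ((n + ℓ - i : ℕ) : ℝ) * u i t * u (n + ℓ - i) t)
    - 2 * (n : ℝ) * u n t / m1large ℓ u t

/-- A large-cluster solution on `[0,T]`: a nonnegative family
`u_n ∈ C¹([0,T],[0,1])` (`n > ℓ`) solving the large-cluster system, whose
first-moment series converges uniformly on `[0,T]`. -/
structure IsLargeSolution (ℓ : ℕ) (T : ℝ) (u : ℕ → ℝ → ℝ) : Prop where
  mem : ∀ n, ℓ < n → ∀ t ∈ Set.Icc (0 : ℝ) T, u n t ∈ Set.Icc (0 : ℝ) 1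
  contDiff : ∀ n, ℓ < n → ContDiffOn ℝ 1 (u n) (Set.Icc 0 T)
  ode : ∀ n, ℓ < n → ∀ t ∈ Set.Icc (0 : ℝ) T,
    HasDerivWithinAt (u n) (largeRHS ℓ u n t) (Set.Icc 0 T) t
  m1_unif : TendstoUniformlyOn
    (fun N t => ∑ i ∈ Finset.range N, if ℓ + 1 ≤ i then (i : ℝ) * u i t else 0)
    (m1large ℓ u) atTop (Set.Icc 0 T)

/-- A pre-gelation large-cluster solution: in addition the second-moment series
`m₂(t) = ∑_{i > ℓ} i² u_i(t)` converges uniformly on `[0,T]`. -/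
structure IsPreGelLargeSolution (ℓ : ℕ) (T : ℝ) (u : ℕ → ℝ → ℝ)
    extends IsLargeSolution ℓ T u : Prop where
  m2_unif : TendstoUniformlyOn
    (fun N t => ∑ i ∈ Finset.range N, if ℓ + 1 ≤ i then (i : ℝ) ^ 2 * u i t else 0)
    (fun t => ∑' i : ℕ, if ℓ + 1 ≤ i then (i : ℝ) ^ 2 * u i t else 0)
    atTop (Set.Icc 0 T)

/-- The quadratic gain term in the shifted index `j = n - (ℓ + 1)`: the Cauchy square of `x`,
shifted by one. -/
def shiftConv (x : ℕ → ℝ) : ℕ → ℝ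
  | 0 => 0
  | j + 1 => ∑ ab ∈ antidiagonal j, x ab.1 * x ab.2

lemma shiftConv_nonneg {x : ℕ → ℝ} (hx : ∀ j, 0 ≤ x j) (j : ℕ) : 0 ≤ shiftConv x j := by
  cases j with
  | zero => exact le_rfl
  | succ j => exact sum_nonneg fun ab _ => mul_nonneg (hx _) (hx _)

lemma shiftConv_congr {x y : ℕ → ℝ} {j : ℕ} (h : ∀ i < j, x i = y i) :
    shiftConv x j = shiftConv y j := by
  cases j with
  | zero => rfl
  | succ j =>
    refine sum_congr rfl fun ab hab => ?_
    have := mem_antidiagonal.1 hab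
    rw [h ab.1 (by omega), h ab.2 (by omega)]

lemma sum_Icc_gain_eq_shiftConv (ℓ j : ℕ) (u : ℕ → ℝ) :
    ∑ i ∈ Finset.Icc (ℓ + 1) (ℓ + 1 + j - 1),
        (i : ℝ) * ((ℓ + 1 + j + ℓ - i : ℕ) : ℝ) * u i * u (ℓ + 1 + j + ℓ - i) =
      shiftConv (fun a => ((ℓ : ℝ) + 1 + a) * u (ℓ + 1 + a)) j := by
  cases j with
  | zero => simp [shiftConv]
  | succ j =>
    have hIcc : Finset.Icc (ℓ + 1) (ℓ + 1 + (j + 1) - 1) = Finset.Ico (ℓ + 1) (ℓ + 1 + (j + 1)) := by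
      ext i; simp only [Finset.mem_Icc, Finset.mem_Ico]; omega
    rw [hIcc, sum_Ico_eq_sum_range, shiftConv, Finset.Nat.sum_antidiagonal_eq_sum_range_succ_mk,
      Nat.add_sub_cancel_left]
    refine sum_congr rfl fun a ha => ?_
    have ha' := Finset.mem_range.1 ha
    have h1 : ℓ + 1 + (j + 1) + ℓ - (ℓ + 1 + a) = ℓ + 1 + (j - a) := by omega
    rw [h1]
    push_cast
    ring

lemma sum_range_shiftConv_le {x : ℕ → ℝ} (hx : ∀ j, 0 ≤ x j) (N : ℕ) :
    ∑ j ∈ range N, shiftConv x j ≤ (∑ j ∈ range N, x j) ^ 2 := by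
  cases N with
  | zero => simp
  | succ N =>
    rw [sum_range_succ' (shiftConv x) N]
    simp only [shiftConv, add_zero, Finset.Nat.sum_antidiagonal_eq_sum_range_succ_mk]
    rw [sum_range_diag_flip N fun a b => x a * x b, sq, sum_mul_sum]
    calc _ ≤ ∑ a ∈ range N, ∑ b ∈ range (N + 1), x a * x b := by
          refine sum_le_sum fun a _ => sum_le_sum_of_subset_of_nonneg ?_ ?_
          · exact range_subset_range.2 (by omega)
          · exact fun b _ _ => mul_nonneg (hx a) (hx b)
      _ ≤ _ := by
          refine sum_le_sum_of_subset_of_nonneg (range_subset_range.2 (by omega)) ?_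
          exact fun a _ _ => sum_nonneg fun b _ => mul_nonneg (hx a) (hx b)

lemma HasSum.sum_mul_antidiagonal {f g : ℕ → ℝ} {A B : ℝ} (hf : HasSum f A) (hg : HasSum g B) :
    HasSum (fun n => ∑ ab ∈ antidiagonal n, f ab.1 * g ab.2) (A * B) := by
  have hf' := hf.summable.norm
  have hg' := hg.summable.norm
  rw [← hf.tsum_eq, ← hg.tsum_eq,
    tsum_mul_tsum_eq_tsum_sum_antidiagonal_of_summable_norm hf' hg']
  exact (summable_norm_sum_mul_antidiagonal_of_summable_norm hf' hg').of_norm.hasSum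

lemma hasSum_weighted_shiftConv {ℓ : ℝ} {x : ℕ → ℝ} {A Q : ℝ} (hA : HasSum x A)
    (hQ : HasSum (fun j : ℕ => (ℓ + 1 + j) * x j) Q) :
    HasSum (fun j : ℕ => (ℓ + 1 + j) * shiftConv x j) (2 * A * Q - ℓ * A ^ 2) := by
  rw [← hasSum_nat_add_iff' 1]
  have h := ((hQ.sum_mul_antidiagonal hA).add (hA.sum_mul_antidiagonal hQ)).sub
    ((hA.sum_mul_antidiagonal hA).mul_left ℓ)
  convert h using 1
  · funext j
    rw [shiftConv, mul_sum, mul_sum, ← sum_add_distrib, ← sum_sub_distrib]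
    refine sum_congr rfl fun ab hab => ?_
    rw [← mem_antidiagonal.1 hab]
    push_cast
    ring
  · simp [shiftConv]
    ring

/-- The first-moment balance for a solution of the shifted system with coefficient `μ`. -/
lemma first_moment_balance {ℓ : ℝ} (hℓ : 0 ≤ ℓ) {s C D : ℝ} (hs : 0 ≤ s) {x : ℕ → ℝ → ℝ}
    {μ A Q : ℝ → ℝ} (hx : ∀ j, ∀ t ∈ Set.Icc 0 s, 0 ≤ x j t)
    (hμ : ContinuousOn μ (Set.Icc 0 s)) (hμD : ∀ t ∈ Set.Icc 0 s, |μ t| ≤ D)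
    (hode : ∀ j : ℕ, ∀ t ∈ Set.Icc 0 s, HasDerivWithinAt (x j)
      ((ℓ + 1 + j) * (μ t ^ 2 * shiftConv (x · t) j - 2 * μ t * x j t)) (Set.Icc 0 s) t)
    (hA : ∀ t ∈ Set.Icc 0 s, HasSum (x · t) (A t))
    (hQ : ∀ t ∈ Set.Icc 0 s, HasSum (fun j : ℕ => (ℓ + 1 + j) * x j t) (Q t))
    (hQC : ∀ t ∈ Set.Icc 0 s, Q t ≤ C) :
    A s - A 0 =
      ∫ t in (0 : ℝ)..s, (μ t ^ 2 * (2 * A t * Q t - ℓ * A t ^ 2) - 2 * μ t * Q t) := by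
  have hxc : ∀ j, ContinuousOn (x j) (Set.Icc 0 s) :=
    fun j t ht => (hode j t ht).continuousWithinAt
  have hcc : ∀ j, ContinuousOn (fun t => shiftConv (x · t) j) (Set.Icc 0 s) := by
    intro j
    cases j with
    | zero => exact continuousOn_const
    | succ j => exact continuousOn_finsetSum _ fun ab _ => (hxc _).mul (hxc _)
  set d : ℕ → ℝ → ℝ := fun j t =>
    (ℓ + 1 + j) * (μ t ^ 2 * shiftConv (x · t) j - 2 * μ t * x j t) with hd
  have hdc : ∀ j, ContinuousOn (d j) (Set.Icc 0 s) := fun j =>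
    continuousOn_const.mul (((hμ.pow 2).mul (hcc j)).sub ((continuousOn_const.mul hμ).mul (hxc j)))
  have hsumd : ∀ t ∈ Set.Icc 0 s, HasSum (d · t)
      (μ t ^ 2 * (2 * A t * Q t - ℓ * A t ^ 2) - 2 * μ t * Q t) := by
    intro t ht
    refine (((hasSum_weighted_shiftConv (hA t ht) (hQ t ht)).mul_left (μ t ^ 2)).sub
      ((hQ t ht).mul_left (2 * μ t))).congr_fun fun j => ?_
    simp only [hd]
    ring
  have hftc : ∀ N : ℕ, ∫ t in (0 : ℝ)..s, ∑ j ∈ range N, d j t =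
      ∑ j ∈ range N, x j s - ∑ j ∈ range N, x j 0 := by
    intro N
    refine intervalIntegral.integral_eq_sub_of_hasDerivAt_of_le hs
      (f := fun t => ∑ j ∈ range N, x j t) (continuousOn_finsetSum _ fun j _ => hxc j) ?_ ?_
    · intro t ht
      exact HasDerivAt.fun_sum fun j _ => (hode j t ⟨ht.1.le, ht.2.le⟩).hasDerivAt
        (Icc_mem_nhds ht.1 ht.2)
    · refine ContinuousOn.intervalIntegrable ?_
      rw [Set.uIcc_of_le hs]
      exact continuousOn_finsetSum _ fun j _ => hdc j
  have hAlim : Tendsto (fun N : ℕ => ∑ j ∈ range N, x j s - ∑ j ∈ range N, x j 0) atTop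
      (𝓝 (A s - A 0)) :=
    (hA s ⟨hs, le_rfl⟩).tendsto_sum_nat.sub (hA 0 ⟨le_rfl, hs⟩).tendsto_sum_nat
  refine tendsto_nhds_unique hAlim ?_
  simp_rw [← hftc]
  refine intervalIntegral.tendsto_integral_filter_of_dominated_convergence
    (fun _ => D ^ 2 * (2 * C * C) + 2 * D * C) ?_ ?_ ?_ ?_
  · refine Eventually.of_forall fun N => ?_
    rw [Set.uIoc_of_le hs]
    exact ((continuousOn_finsetSum _ fun j _ => hdc j).mono
      Set.Ioc_subset_Icc_self).aestronglyMeasurable measurableSet_Ioc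
  · refine Eventually.of_forall fun N => Eventually.of_forall fun t ht => ?_
    rw [Set.uIoc_of_le hs] at ht
    replace ht := Set.Ioc_subset_Icc_self ht
    have hp : ∀ j : ℕ, 0 ≤ ℓ + 1 + j := fun j => by positivity
    have hA0 : 0 ≤ A t := (hA t ht).nonneg fun j => hx j t ht
    have hAQ : A t ≤ Q t := by
      refine hasSum_le (fun j => ?_) (hA t ht) (hQ t ht)
      have := mul_nonneg (add_nonneg hℓ (Nat.cast_nonneg (α := ℝ) j)) (hx j t ht)
      linarith
    have hC := hQC t ht
    have hD := hμD t ht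
    have hD0 := (abs_nonneg _).trans hD
    have h1 : ∑ j ∈ range N, (ℓ + 1 + j) * shiftConv (x · t) j ≤ 2 * C * C := by
      refine (sum_le_hasSum _ (fun j _ => mul_nonneg (hp j)
        (shiftConv_nonneg (fun i => hx i t ht) j))
        (hasSum_weighted_shiftConv (hA t ht) (hQ t ht))).trans ?_
      have : A t * Q t ≤ C * C := mul_le_mul (hAQ.trans hC) hC (hA0.trans hAQ)
        (hA0.trans (hAQ.trans hC))
      nlinarith [mul_nonneg hℓ (sq_nonneg (A t))]
    have h1' : 0 ≤ ∑ j ∈ range N, (ℓ + 1 + j) * shiftConv (x · t) j :=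
      sum_nonneg fun j _ => mul_nonneg (hp j) (shiftConv_nonneg (fun i => hx i t ht) j)
    have h2 : ∑ j ∈ range N, (ℓ + 1 + j) * x j t ≤ C :=
      (sum_le_hasSum _ (fun j _ => mul_nonneg (hp j) (hx j t ht)) (hQ t ht)).trans hC
    have h2' : 0 ≤ ∑ j ∈ range N, (ℓ + 1 + j) * x j t :=
      sum_nonneg fun j _ => mul_nonneg (hp j) (hx j t ht)
    have h3 : ∑ j ∈ range N, d j t =
        μ t ^ 2 * ∑ j ∈ range N, (ℓ + 1 + j) * shiftConv (x · t) j
          - 2 * μ t * ∑ j ∈ range N, (ℓ + 1 + j) * x j t := by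
      rw [mul_sum, mul_sum, ← sum_sub_distrib]
      refine sum_congr rfl fun j _ => ?_
      simp only [hd]
      ring
    rw [h3, Real.norm_eq_abs]
    refine (abs_sub _ _).trans (add_le_add ?_ ?_)
    · rw [abs_mul, abs_of_nonneg h1', abs_pow]
      gcongr
    · rw [abs_mul, abs_mul, abs_of_nonneg h2', abs_of_nonneg (zero_le_two (α := ℝ))]
      gcongr
  · exact intervalIntegrable_const
  · refine Eventually.of_forall fun t ht => ?_
    rw [Set.uIoc_of_le hs] at ht
    exact (hsumd t (Set.Ioc_subset_Icc_self ht)).tendsto_sum_nat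

/-- Variation of constants for the `j`-th equation of the shifted system, with the gain term
evaluated at `x`. -/
def duhamelStep (ℓ : ℝ) (μ : ℝ → ℝ) (x0 : ℕ → ℝ) (x : ℕ → ℝ → ℝ) (j : ℕ) (t : ℝ) : ℝ :=
  Real.exp (-(2 * (ℓ + 1 + j) * ∫ τ in (0 : ℝ)..t, μ τ)) *
    (x0 j + ∫ σ in (0 : ℝ)..t, Real.exp (2 * (ℓ + 1 + j) * ∫ τ in (0 : ℝ)..σ, μ τ) *
      ((ℓ + 1 + j) * (μ σ ^ 2 * shiftConv (x · σ) j)))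

/-- The solution of the (triangular) shifted system with prescribed coefficient `μ`. -/
def triangularSol (ℓ : ℝ) (μ : ℝ → ℝ) (x0 : ℕ → ℝ) (j : ℕ) : ℝ → ℝ :=
  duhamelStep ℓ μ x0 (fun i => if _ : i < j then triangularSol ℓ μ x0 i else 0) j
termination_by j

section TriangularSol

variable {ℓ : ℝ} {μ : ℝ → ℝ} {x0 : ℕ → ℝ}

lemma triangularSol_eq (ℓ : ℝ) (μ : ℝ → ℝ) (x0 : ℕ → ℝ) (j : ℕ) :
    triangularSol ℓ μ x0 j = duhamelStep ℓ μ x0 (triangularSol ℓ μ x0) j := by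
  rw [triangularSol]
  funext t
  simp only [duhamelStep]
  congr 2
  refine intervalIntegral.integral_congr fun σ _ => ?_
  congr 3
  exact shiftConv_congr fun i hi => by simp [hi]

lemma triangularSol_zero (ℓ : ℝ) (μ : ℝ → ℝ) (x0 : ℕ → ℝ) (j : ℕ) :
    triangularSol ℓ μ x0 j 0 = x0 j := by
  rw [triangularSol_eq]
  simp [duhamelStep]

lemma continuous_shiftConv {x : ℕ → ℝ → ℝ} {j : ℕ} (hx : ∀ i < j, Continuous (x i)) :
    Continuous fun t => shiftConv (x · t) j := by
  cases j with
  | zero => exact continuous_const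
  | succ j =>
    refine continuous_finsetSum _ fun ab hab => ?_
    have := mem_antidiagonal.1 hab
    exact (hx _ (by omega)).mul (hx _ (by omega))

lemma hasDerivAt_duhamelStep (hμ : Continuous μ) {x : ℕ → ℝ → ℝ} {j : ℕ}
    (hx : ∀ i < j, Continuous (x i)) (t : ℝ) :
    HasDerivAt (duhamelStep ℓ μ x0 x j)
      ((ℓ + 1 + j) * (μ t ^ 2 * shiftConv (x · t) j - 2 * μ t * duhamelStep ℓ μ x0 x j t)) t := by
  have hΦ : ∀ t, HasDerivAt (fun t => ∫ τ in (0 : ℝ)..t, μ τ) (μ t) t := fun t =>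
    (hμ.integral_hasStrictDerivAt 0 t).hasDerivAt
  have hΦc : Continuous fun t => ∫ τ in (0 : ℝ)..t, μ τ :=
    continuous_iff_continuousAt.2 fun t => (hΦ t).continuousAt
  have hg : Continuous fun σ => Real.exp (2 * (ℓ + 1 + j) * ∫ τ in (0 : ℝ)..σ, μ τ) *
      ((ℓ + 1 + j) * (μ σ ^ 2 * shiftConv (x · σ) j)) :=
    (Real.continuous_exp.comp (continuous_const.mul hΦc)).mul
      (continuous_const.mul ((hμ.pow 2).mul (continuous_shiftConv hx)))
  have hI := (hg.integral_hasStrictDerivAt 0 t).hasDerivAt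
  have hE := (((hΦ t).const_mul (2 * (ℓ + 1 + j))).neg).exp
  refine (hE.mul (hI.const_add (x0 j))).congr_deriv ?_
  simp only [duhamelStep, Pi.neg_apply]
  have hexp : Real.exp (-(2 * (ℓ + 1 + j) * ∫ τ in (0 : ℝ)..t, μ τ)) *
      Real.exp (2 * (ℓ + 1 + j) * ∫ τ in (0 : ℝ)..t, μ τ) = 1 := by
    rw [← Real.exp_add]; simp
  linear_combination ((ℓ + 1 + j) * (μ t ^ 2 * shiftConv (x · t) j)) * hexp

lemma continuous_triangularSol (hμ : Continuous μ) (j : ℕ) :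
    Continuous (triangularSol ℓ μ x0 j) := by
  induction j using Nat.strong_induction_on with
  | _ j ih =>
    rw [triangularSol_eq]
    exact continuous_iff_continuousAt.2 fun t => (hasDerivAt_duhamelStep hμ ih t).continuousAt

lemma hasDerivAt_triangularSol (hμ : Continuous μ) (j : ℕ) (t : ℝ) :
    HasDerivAt (triangularSol ℓ μ x0 j)
      ((ℓ + 1 + j) * (μ t ^ 2 * shiftConv (triangularSol ℓ μ x0 · t) j
        - 2 * μ t * triangularSol ℓ μ x0 j t)) t := by
  have h := hasDerivAt_duhamelStep (ℓ := ℓ) (x0 := x0) hμ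
    (fun i (_ : i < j) => continuous_triangularSol (ℓ := ℓ) (x0 := x0) hμ i) t
  rwa [← triangularSol_eq] at h

lemma triangularSol_nonneg (hℓ : 0 ≤ ℓ) (hx0 : ∀ j, 0 ≤ x0 j) (j : ℕ) {t : ℝ} (ht : 0 ≤ t) :
    0 ≤ triangularSol ℓ μ x0 j t := by
  induction j using Nat.strong_induction_on generalizing t with
  | _ j ih =>
    rw [triangularSol_eq]
    refine mul_nonneg (Real.exp_pos _).le (add_nonneg (hx0 j) ?_)
    refine intervalIntegral.integral_nonneg ht fun σ hσ => ?_
    have hc : 0 ≤ shiftConv (triangularSol ℓ μ x0 · σ) j := by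
      rw [shiftConv_congr (y := fun i => if i < j then triangularSol ℓ μ x0 i σ else 0)
        fun i hi => by simp [hi]]
      refine shiftConv_nonneg (fun i => ?_) j
      split_ifs with hi
      exacts [ih i hi hσ.1, le_rfl]
    positivity

/-- A Catalan majorant, growing exponentially in time, for the triangular system. -/
lemma triangularSol_le_catalan (hℓ : 0 ≤ ℓ) (hμ : Continuous μ) (hx0 : ∀ j, 0 ≤ x0 j)
    {D K r : ℝ} (hμ0 : ∀ t, 0 ≤ μ t) (hμD : ∀ t, μ t ≤ D) (hK : 0 ≤ K) (hr : 0 ≤ r)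
    (h0 : ∀ j, x0 j ≤ K * catalan j * r ^ (j + 1)) (j : ℕ) {t : ℝ} (ht : 0 ≤ t) :
    triangularSol ℓ μ x0 j t ≤
      K * catalan j * (r * Real.exp ((ℓ + 1) * D ^ 2 * K * t)) ^ (j + 1) := by
  have hD : 0 ≤ D := (hμ0 0).trans (hμD 0)
  set lam := (ℓ + 1) * D ^ 2 * K with hlam
  induction j using Nat.strong_induction_on generalizing t with
  | _ j ih =>
    have hR : ∀ t, HasDerivAt (fun t => K * catalan j * (r * Real.exp (lam * t)) ^ (j + 1))
        (K * catalan j * ((j + 1) * lam * (r * Real.exp (lam * t)) ^ (j + 1))) t := by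
      intro t
      have h1 : HasDerivAt (fun t => r * Real.exp (lam * t)) (r * (Real.exp (lam * t) * lam)) t := by
        simpa using ((hasDerivAt_id t).const_mul lam).exp.const_mul r
      refine ((h1.fun_pow (j + 1)).const_mul _).congr_deriv ?_
      push_cast
      ring
    have hconv : ∀ t, 0 ≤ t → shiftConv (triangularSol ℓ μ x0 · t) j ≤
        K ^ 2 * catalan j * (r * Real.exp (lam * t)) ^ (j + 1) := by
      intro t ht
      cases j with
      | zero => simp only [shiftConv]; positivity
      | succ j =>
        rw [shiftConv, catalan_succ', Nat.cast_sum, mul_sum, sum_mul]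
        refine sum_le_sum fun ab hab => ?_
        have hab' := mem_antidiagonal.1 hab
        refine (mul_le_mul (ih ab.1 (by omega) ht) (ih ab.2 (by omega) ht)
          (triangularSol_nonneg hℓ hx0 _ ht) (by positivity)).trans_eq ?_
        rw [← hab']
        push_cast
        ring
    have hdiff : ∀ t, HasDerivAt _ _ t := fun t =>
      (hR t).sub (hasDerivAt_triangularSol (ℓ := ℓ) (x0 := x0) hμ j t)
    have hmono := monotoneOn_of_deriv_nonneg (convex_Ici (0 : ℝ))
      (fun t _ => (hdiff t).continuousAt.continuousWithinAt)
      (fun t _ => (hdiff t).differentiableAt.differentiableWithinAt) (fun t ht => ?_)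
    · have h := hmono Set.self_mem_Ici ht ht
      have h00 := h0 j
      simp only [Pi.sub_apply, mul_zero, Real.exp_zero, mul_one, triangularSol_zero] at h
      linarith
    · rw [interior_Ici] at ht
      replace ht := (Set.mem_Ioi.1 ht).le
      rw [(hdiff t).deriv, sub_nonneg]
      have hc := hconv t ht
      have hn := triangularSol_nonneg (μ := μ) hℓ hx0 j ht
      set X := (r * Real.exp (lam * t)) ^ (j + 1)
      have hX : 0 ≤ X := by positivity
      have hμt := hμ0 t
      have hcn := shiftConv_nonneg (x := (triangularSol ℓ μ x0 · t))
        (fun i => triangularSol_nonneg hℓ hx0 i ht) j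
      calc (ℓ + 1 + j) * (μ t ^ 2 * shiftConv (triangularSol ℓ μ x0 · t) j
              - 2 * μ t * triangularSol ℓ μ x0 j t)
          ≤ (ℓ + 1 + j) * (μ t ^ 2 * shiftConv (triangularSol ℓ μ x0 · t) j) := by
            gcongr
            exact sub_le_self _ (by positivity)
        _ ≤ (ℓ + 1 + j) * (D ^ 2 * (K ^ 2 * catalan j * X)) := by
            have := hμD t
            gcongr
        _ ≤ ((j + 1) * (ℓ + 1)) * (D ^ 2 * (K ^ 2 * catalan j * X)) := by
            gcongr
            nlinarith [mul_nonneg hℓ (Nat.cast_nonneg (α := ℝ) j)]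
        _ = _ := by rw [hlam]; ring

/-- Where `μ` is smooth, so is the solution of the triangular system. -/
lemma contDiffOn_triangularSol (hμ : Continuous μ) {T : ℝ} (hT : 0 < T)
    (hμs : ContDiffOn ℝ (⊤ : ℕ∞) μ (Set.Icc 0 T)) (j : ℕ) :
    ContDiffOn ℝ (⊤ : ℕ∞) (triangularSol ℓ μ x0 j) (Set.Icc 0 T) := by
  induction j using Nat.strong_induction_on with
  | _ j ih =>
    have hconv : ContDiffOn ℝ (⊤ : ℕ∞) (fun t => shiftConv (triangularSol ℓ μ x0 · t) j)
        (Set.Icc 0 T) := by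
      cases j with
      | zero => exact contDiffOn_const
      | succ j =>
        refine ContDiffOn.sum fun ab hab => ?_
        have := mem_antidiagonal.1 hab
        exact (ih _ (by omega)).mul (ih _ (by omega))
    rw [contDiffOn_infty]
    intro n
    induction n with
    | zero => exact contDiffOn_zero.2 (continuous_triangularSol hμ j).continuousOn
    | succ n ihn =>
      have hn : ((n : ℕ∞) : WithTop ℕ∞) ≤ ((⊤ : ℕ∞) : WithTop ℕ∞) :=
        WithTop.coe_le_coe.2 le_top
      push_cast at hn ihn ⊢
      rw [contDiffOn_succ_iff_derivWithin (uniqueDiffOn_Icc hT)]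
      refine ⟨fun t _ => (hasDerivAt_triangularSol hμ j t).differentiableAt.differentiableWithinAt,
        by simp, ?_⟩
      refine ContDiffOn.congr (f := fun t => (ℓ + 1 + j) * (μ t ^ 2 *
        shiftConv (triangularSol ℓ μ x0 · t) j - 2 * μ t * triangularSol ℓ μ x0 j t)) ?_
        fun t ht => (hasDerivAt_triangularSol hμ j t).hasDerivWithinAt.derivWithin
          (uniqueDiffOn_Icc hT t ht)
      exact contDiffOn_const.mul ((((hμs.of_le hn).pow 2).mul (hconv.of_le hn)).sub
        ((contDiffOn_const.mul (hμs.of_le hn)).mul ihn))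

/-- Uniqueness for the triangular system with prescribed coefficient. -/
lemma eqOn_triangularSol (hμ : Continuous μ) {T : ℝ} {y : ℕ → ℝ → ℝ} (hy0 : ∀ j, y j 0 = x0 j)
    (hy : ∀ j : ℕ, ∀ t ∈ Set.Icc 0 T, HasDerivWithinAt (y j)
      ((ℓ + 1 + j) * (μ t ^ 2 * shiftConv (y · t) j - 2 * μ t * y j t)) (Set.Icc 0 T) t) (j : ℕ) :
    Set.EqOn (y j) (triangularSol ℓ μ x0 j) (Set.Icc 0 T) := by
  induction j using Nat.strong_induction_on with
  | _ j ih =>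
    have hΦ : ∀ t, HasDerivAt (fun t => ∫ τ in (0 : ℝ)..t, μ τ) (μ t) t := fun t =>
      (hμ.integral_hasStrictDerivAt 0 t).hasDerivAt
    set E : ℝ → ℝ := fun t => Real.exp (2 * (ℓ + 1 + j) * ∫ τ in (0 : ℝ)..t, μ τ) *
      (y j t - triangularSol ℓ μ x0 j t) with hE
    have hd : ∀ t ∈ Set.Icc 0 T, HasDerivWithinAt E 0 (Set.Icc 0 T) t := by
      intro t ht
      have h := (((hΦ t).const_mul (2 * (ℓ + 1 + j))).exp.hasDerivWithinAt (s := Set.Icc 0 T)).mul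
        ((hy j t ht).sub
          (hasDerivAt_triangularSol (ℓ := ℓ) (x0 := x0) hμ j t).hasDerivWithinAt)
      refine h.congr_deriv ?_
      rw [shiftConv_congr (x := (y · t)) (y := (triangularSol ℓ μ x0 · t))
        fun i hi => ih i hi ht]
      simp only [Pi.sub_apply]
      ring
    have hconst := constant_of_has_deriv_right_zero (f := E) (a := 0) (b := T)
      (fun t ht => (hd t ht).continuousWithinAt)
      (fun t ht => (hd t ⟨ht.1, ht.2.le⟩).mono_of_mem_nhdsWithin
        (mem_of_superset (Icc_mem_nhdsGE ht.2) (Set.Icc_subset_Icc_left ht.1)))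
    intro t ht
    have h := hconst t ht
    simp only [hE, hy0, triangularSol_zero, sub_self, mul_zero] at h
    exact sub_eq_zero.1 ((mul_eq_zero.1 h).resolve_left (Real.exp_pos _).ne')

end TriangularSol

/-- Short-time consistency: if the coefficient is `1 / (M - ℓ t)`, then the first moment of a
summably dominated solution of the shifted system is indeed `M - ℓ t`. -/
lemma hasSum_first_moment_of_dominated {ℓ : ℝ} (hℓ : 0 ≤ ℓ) {T M D : ℝ} (hT : 0 ≤ T)
    {x : ℕ → ℝ → ℝ} {μ : ℝ → ℝ} {b : ℕ → ℝ} (hx : ∀ j, ∀ t ∈ Set.Icc 0 T, 0 ≤ x j t)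
    (hxb : ∀ j, ∀ t ∈ Set.Icc 0 T, x j t ≤ b j)
    (hb : Summable fun j : ℕ => (ℓ + 1 + j) * b j)
    (hM : ∀ t ∈ Set.Icc 0 T, 0 ≤ M - ℓ * t)
    (hμ : ContinuousOn μ (Set.Icc 0 T)) (hμD : ∀ t ∈ Set.Icc 0 T, |μ t| ≤ D)
    (hμM : ∀ t ∈ Set.Icc 0 T, μ t * (M - ℓ * t) = 1)
    (hode : ∀ j : ℕ, ∀ t ∈ Set.Icc 0 T, HasDerivWithinAt (x j)
      ((ℓ + 1 + j) * (μ t ^ 2 * shiftConv (x · t) j - 2 * μ t * x j t)) (Set.Icc 0 T) t)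
    (h0 : HasSum (x · 0) M)
    (hsmall : D ^ 2 * (2 * (∑' j : ℕ, (ℓ + 1 + j) * b j) +
      ℓ * ((∑' j : ℕ, (ℓ + 1 + j) * b j) + M)) * T < 1) :
    ∀ t ∈ Set.Icc 0 T, HasSum (x · t) (M - ℓ * t) := by
  set C := ∑' j : ℕ, (ℓ + 1 + j) * b j
  have hT0 : (0 : ℝ) ∈ Set.Icc 0 T := ⟨le_rfl, hT⟩
  have hxc : ∀ j, ContinuousOn (x j) (Set.Icc 0 T) :=
    fun j t ht => (hode j t ht).continuousWithinAt
  have hb0 : ∀ j, 0 ≤ b j := fun j => (hx j 0 hT0).trans (hxb j 0 hT0)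
  have hble : ∀ j : ℕ, b j ≤ (ℓ + 1 + j) * b j := fun j => by
    nlinarith [mul_nonneg (add_nonneg hℓ (Nat.cast_nonneg (α := ℝ) j)) (hb0 j)]
  have hbs : Summable b := hb.of_nonneg_of_le hb0 hble
  have hxn : ∀ j, ∀ t ∈ Set.Icc 0 T, ‖x j t‖ ≤ b j := fun j t ht => by
    rw [Real.norm_of_nonneg (hx j t ht)]; exact hxb j t ht
  have hpxn : ∀ j : ℕ, ∀ t ∈ Set.Icc 0 T, ‖(ℓ + 1 + j) * x j t‖ ≤ (ℓ + 1 + j) * b j :=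
    fun j t ht => by
      have hp : 0 ≤ ℓ + 1 + j := by positivity
      rw [norm_mul, Real.norm_of_nonneg hp]
      exact mul_le_mul_of_nonneg_left (hxn j t ht) hp
  set A : ℝ → ℝ := fun t => ∑' j, x j t
  set Q : ℝ → ℝ := fun t => ∑' j : ℕ, (ℓ + 1 + j) * x j t
  have hA : ∀ t ∈ Set.Icc 0 T, HasSum (x · t) (A t) := fun t ht =>
    (hbs.of_norm_bounded fun j => hxn j t ht).hasSum
  have hQ : ∀ t ∈ Set.Icc 0 T, HasSum (fun j : ℕ => (ℓ + 1 + j) * x j t) (Q t) := fun t ht =>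
    (hb.of_norm_bounded fun j => hpxn j t ht).hasSum
  have hAc : ContinuousOn A (Set.Icc 0 T) := continuousOn_tsum hxc hbs hxn
  have hQc : ContinuousOn Q (Set.Icc 0 T) :=
    continuousOn_tsum (fun j => continuousOn_const.mul (hxc j)) hb hpxn
  have hQC : ∀ t ∈ Set.Icc 0 T, Q t ≤ C := fun t ht =>
    hasSum_le (fun j => (le_abs_self _).trans (hpxn j t ht)) (hQ t ht) hb.hasSum
  have hAC : ∀ t ∈ Set.Icc 0 T, A t ≤ C := fun t ht =>
    hasSum_le (fun j => (hxb j t ht).trans (hble j)) (hA t ht) hb.hasSum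
  have hA0 : ∀ t ∈ Set.Icc 0 T, 0 ≤ A t := fun t ht => (hA t ht).nonneg fun j => hx j t ht
  have hQ0 : ∀ t ∈ Set.Icc 0 T, 0 ≤ Q t := fun t ht =>
    (hQ t ht).nonneg fun j => mul_nonneg (by positivity) (hx j t ht)
  have hE : ∀ t ∈ Set.Icc 0 T, A t - (M - ℓ * t) =
      ∫ τ in (0 : ℝ)..t, μ τ ^ 2 * (A τ - (M - ℓ * τ)) * (2 * Q τ - ℓ * (A τ + (M - ℓ * τ))) := by
    intro t ht
    have hsub : Set.Icc 0 t ⊆ Set.Icc 0 T := Set.Icc_subset_Icc_right ht.2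
    have hbal := first_moment_balance hℓ ht.1 (fun j τ hτ => hx j τ (hsub hτ)) (hμ.mono hsub)
      (fun τ hτ => hμD τ (hsub hτ)) (fun j τ hτ => (hode j τ (hsub hτ)).mono hsub)
      (fun τ hτ => hA τ (hsub hτ)) (fun τ hτ => hQ τ (hsub hτ)) (fun τ hτ => hQC τ (hsub hτ))
    rw [(hA 0 hT0).unique h0] at hbal
    have hint : IntervalIntegrable
        (fun τ => μ τ ^ 2 * (2 * A τ * Q τ - ℓ * A τ ^ 2) - 2 * μ τ * Q τ)
        MeasureTheory.volume 0 t := by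
      refine ContinuousOn.intervalIntegrable ?_
      rw [Set.uIcc_of_le ht.1]
      refine ContinuousOn.mono ?_ hsub
      fun_prop
    have hadd := intervalIntegral.integral_add hint
      (intervalIntegrable_const (μ := MeasureTheory.volume) (a := 0) (b := t) (c := ℓ))
    rw [intervalIntegral.integral_const, ← hbal, smul_eq_mul] at hadd
    have hcongr : ∫ τ in (0 : ℝ)..t, μ τ ^ 2 * (A τ - (M - ℓ * τ)) *
        (2 * Q τ - ℓ * (A τ + (M - ℓ * τ))) =
        ∫ τ in (0 : ℝ)..t, (μ τ ^ 2 * (2 * A τ * Q τ - ℓ * A τ ^ 2) - 2 * μ τ * Q τ + ℓ) := by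
      refine intervalIntegral.integral_congr fun τ hτ => ?_
      rw [Set.uIcc_of_le ht.1] at hτ
      have h1 := hμM τ (hsub hτ)
      linear_combination (-2 * μ τ * Q τ + ℓ * (μ τ * (M - ℓ * τ) + 1)) * h1
    rw [hcongr, hadd]
    ring
  have hEc : ContinuousOn (fun t => |A t - (M - ℓ * t)|) (Set.Icc 0 T) := by fun_prop
  obtain ⟨t₀, ht₀, hmax⟩ := isCompact_Icc.exists_isMaxOn ⟨0, hT0⟩ hEc
  set ε := |A t₀ - (M - ℓ * t₀)|
  have hε0 : 0 ≤ ε := abs_nonneg _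
  have hM0 : 0 ≤ M := by simpa using hM 0 hT0
  have hC0 : 0 ≤ C := (hA0 0 hT0).trans (hAC 0 hT0)
  have hD0 : 0 ≤ D := (abs_nonneg _).trans (hμD 0 hT0)
  have hbound : ε ≤ D ^ 2 * ε * (2 * C + ℓ * (C + M)) * |t₀ - 0| := by
    refine (congrArg abs (hE t₀ ht₀)).trans_le ?_
    rw [← Real.norm_eq_abs]
    refine intervalIntegral.norm_integral_le_of_norm_le_const fun τ hτ => ?_
    rw [Set.uIoc_of_le ht₀.1] at hτ
    have hτ' : τ ∈ Set.Icc 0 T := ⟨hτ.1.le, hτ.2.trans ht₀.2⟩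
    rw [norm_mul, norm_mul, norm_pow]
    have h1 : ‖μ τ‖ ≤ D := hμD τ hτ'
    have h2 : ‖A τ - (M - ℓ * τ)‖ ≤ ε := hmax hτ'
    have h3 : ‖2 * Q τ - ℓ * (A τ + (M - ℓ * τ))‖ ≤ 2 * C + ℓ * (C + M) := by
      have hMτ := hM τ hτ'
      have hs0 := hA0 τ hτ'
      refine (norm_sub_le _ _).trans (add_le_add ?_ ?_)
      · rw [Real.norm_of_nonneg (mul_nonneg zero_le_two (hQ0 τ hτ'))]
        linarith [hQC τ hτ']
      · rw [Real.norm_of_nonneg (mul_nonneg hℓ (add_nonneg hs0 hMτ))]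
        refine mul_le_mul_of_nonneg_left (add_le_add (hAC τ hτ') ?_) hℓ
        linarith [mul_nonneg hℓ hτ'.1]
    gcongr
  have hle : ε ≤ ε * (D ^ 2 * (2 * C + ℓ * (C + M)) * T) := by
    refine hbound.trans ?_
    rw [sub_zero, abs_of_nonneg ht₀.1]
    calc D ^ 2 * ε * (2 * C + ℓ * (C + M)) * t₀ ≤ D ^ 2 * ε * (2 * C + ℓ * (C + M)) * T := by
          have := ht₀.2
          gcongr
      _ = _ := by ring
  have hεz : ε = 0 := by nlinarith
  intro t ht
  have h : |A t - (M - ℓ * t)| ≤ ε := hmax ht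
  have : A t = M - ℓ * t := sub_eq_zero.1 (abs_nonpos_iff.1 (h.trans hεz.le))
  exact this ▸ hA t ht

/-- Truncated particle numbers do not increase. -/
lemma sum_range_fraction_le {ℓ : ℝ} (hℓ : 0 ≤ ℓ) {T : ℝ} (hT : 0 ≤ T) {x : ℕ → ℝ → ℝ}
    {μ m : ℝ → ℝ} (hx : ∀ j, ∀ t ∈ Set.Icc 0 T, 0 ≤ x j t) (hμ0 : ∀ t ∈ Set.Icc 0 T, 0 ≤ μ t)
    (hμm : ∀ t ∈ Set.Icc 0 T, μ t * m t = 1)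
    (hode : ∀ j : ℕ, ∀ t ∈ Set.Icc 0 T, HasDerivWithinAt (x j)
      ((ℓ + 1 + j) * (μ t ^ 2 * shiftConv (x · t) j - 2 * μ t * x j t)) (Set.Icc 0 T) t)
    (hm : ∀ t ∈ Set.Icc 0 T, HasSum (x · t) (m t)) (N : ℕ) {t : ℝ} (ht : t ∈ Set.Icc 0 T) :
    ∑ j ∈ range N, x j t / (ℓ + 1 + j) ≤ ∑ j ∈ range N, x j 0 / (ℓ + 1 + j) := by
  have hder : ∀ t ∈ Set.Icc 0 T, HasDerivWithinAt
      (fun t => ∑ j ∈ range N, x j t / (ℓ + 1 + j))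
      (μ t ^ 2 * ∑ j ∈ range N, shiftConv (x · t) j - 2 * μ t * ∑ j ∈ range N, x j t)
      (Set.Icc 0 T) t := by
    intro t ht
    refine (HasDerivWithinAt.fun_sum fun j _ => (hode j t ht).div_const (ℓ + 1 + j)).congr_deriv ?_
    rw [mul_sum, mul_sum, ← sum_sub_distrib]
    refine sum_congr rfl fun j _ => ?_
    have hp : ℓ + 1 + j ≠ 0 := by positivity
    field_simp
  refine antitoneOn_of_deriv_nonpos (f := fun t => ∑ j ∈ range N, x j t / (ℓ + 1 + j))
    (convex_Icc 0 T) (fun t ht => (hder t ht).continuousWithinAt)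
    (fun t ht => ?_) (fun t ht => ?_) ⟨le_rfl, hT⟩ ht ht.1
  · exact ((hder t (interior_subset ht)).mono interior_subset).differentiableWithinAt
  · have ht' := interior_subset ht
    rw [interior_Icc] at ht
    rw [((hder t ht').hasDerivAt (Icc_mem_nhds ht.1 ht.2)).deriv]
    have hx' : ∀ j, 0 ≤ x j t := fun j => hx j t ht'
    have h1 := sum_range_shiftConv_le hx' N
    have h2 : ∑ j ∈ range N, x j t ≤ m t := sum_le_hasSum _ (fun j _ => hx' j) (hm t ht')
    have h3 : 0 ≤ ∑ j ∈ range N, x j t := sum_nonneg fun j _ => hx' j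
    have h4 := hμ0 t ht'
    have h5 := hμm t ht'
    set S := ∑ j ∈ range N, x j t
    have h6 : μ t * S ≤ 1 := by nlinarith
    have h7 : 0 ≤ μ t * S := mul_nonneg h4 h3
    have h8 : μ t ^ 2 * ∑ j ∈ range N, shiftConv (x · t) j ≤ μ t ^ 2 * S ^ 2 := by gcongr
    nlinarith

lemma hasSum_largeIndex_iff (ℓ : ℕ) (f : ℕ → ℝ) (S : ℝ) :
    HasSum (fun i => if ℓ + 1 ≤ i then f i else 0) S ↔ HasSum (fun j => f (ℓ + 1 + j)) S := by
  rw [← (add_right_injective (ℓ + 1)).hasSum_iff (f := fun i => if ℓ + 1 ≤ i then f i else 0)]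
  · refine iff_of_eq (congrArg (HasSum · S) (funext fun j => ?_))
    exact if_pos (Nat.le_add_right _ _)
  · intro i hi
    refine if_neg fun h => hi ⟨i - (ℓ + 1), ?_⟩
    dsimp only
    omega

lemma tendstoUniformlyOn_largeIndex {ℓ : ℕ} {f : ℕ → ℝ → ℝ} {b : ℕ → ℝ} {s : Set ℝ}
    (hb : Summable b) (hf : ∀ j, ∀ t ∈ s, |f (ℓ + 1 + j) t| ≤ b j) :
    TendstoUniformlyOn
      (fun N t => ∑ i ∈ Finset.range N, if ℓ + 1 ≤ i then f i t else 0)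
      (fun t => ∑' i : ℕ, if ℓ + 1 ≤ i then f i t else 0) atTop s := by
  refine tendstoUniformlyOn_tsum_nat (f := fun i t => if ℓ + 1 ≤ i then f i t else 0)
    (u := fun i => if ℓ + 1 ≤ i then b (i - (ℓ + 1)) else 0) ?_ fun i t ht => ?_
  · exact ((hasSum_largeIndex_iff ℓ (fun i => b (i - (ℓ + 1))) _).2
      (by simpa using hb.hasSum)).summable
  · split_ifs with h
    · have := hf (i - (ℓ + 1)) t ht
      rwa [Nat.add_sub_cancel' h] at this
    · simp

lemma largeRHS_eq_shiftConv (ℓ : ℕ) (u : ℕ → ℝ → ℝ) (j : ℕ) (t : ℝ) :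
    largeRHS ℓ u (ℓ + 1 + j) t =
      (1 / m1large ℓ u t) ^ 2 * shiftConv (fun a => ((ℓ : ℝ) + 1 + a) * u (ℓ + 1 + a) t) j
        - 2 * (1 / m1large ℓ u t) * (((ℓ : ℝ) + 1 + j) * u (ℓ + 1 + j) t) := by
  rw [largeRHS, sum_Icc_gain_eq_shiftConv ℓ j (fun i => u i t)]
  push_cast
  ring

lemma IsLargeSolution.hasDerivWithinAt_weighted {ℓ : ℕ} {T : ℝ} {v : ℕ → ℝ → ℝ}
    (hv : IsLargeSolution ℓ T v) (j : ℕ) {t : ℝ} (ht : t ∈ Set.Icc 0 T) :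
    HasDerivWithinAt (fun t => ((ℓ : ℝ) + 1 + j) * v (ℓ + 1 + j) t)
      (((ℓ : ℝ) + 1 + j) * ((1 / m1large ℓ v t) ^ 2 *
        shiftConv (fun a => ((ℓ : ℝ) + 1 + a) * v (ℓ + 1 + a) t) j
        - 2 * (1 / m1large ℓ v t) * (((ℓ : ℝ) + 1 + j) * v (ℓ + 1 + j) t))) (Set.Icc 0 T) t := by
  rw [← largeRHS_eq_shiftConv]
  exact (hv.ode (ℓ + 1 + j) (by omega) t ht).const_mul _

lemma IsLargeSolution.hasSum_m1large {ℓ : ℕ} {T : ℝ} {v : ℕ → ℝ → ℝ}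
    (hv : IsLargeSolution ℓ T v) {t : ℝ} (ht : t ∈ Set.Icc 0 T) :
    HasSum (fun j : ℕ => ((ℓ : ℝ) + 1 + j) * v (ℓ + 1 + j) t) (m1large ℓ v t) := by
  have h : HasSum (fun i : ℕ => if ℓ + 1 ≤ i then (i : ℝ) * v i t else 0) (m1large ℓ v t) := by
    refine (hasSum_iff_tendsto_nat_of_nonneg (fun i => ?_) _).2 (hv.m1_unif.tendsto_at ht)
    split_ifs with h
    · exact mul_nonneg (Nat.cast_nonneg _) (hv.mem i h t ht).1
    · exact le_rfl
  simpa using (hasSum_largeIndex_iff ℓ (fun i : ℕ => (i : ℝ) * v i t) _).1 h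

lemma IsPreGelLargeSolution.hasSum_m2 {ℓ : ℕ} {T : ℝ} {v : ℕ → ℝ → ℝ}
    (hv : IsPreGelLargeSolution ℓ T v) {t : ℝ} (ht : t ∈ Set.Icc 0 T) :
    HasSum (fun j : ℕ => ((ℓ : ℝ) + 1 + j) * (((ℓ : ℝ) + 1 + j) * v (ℓ + 1 + j) t))
      (∑' i : ℕ, if ℓ + 1 ≤ i then (i : ℝ) ^ 2 * v i t else 0) := by
  have h : HasSum (fun i : ℕ => if ℓ + 1 ≤ i then (i : ℝ) ^ 2 * v i t else 0)
      (∑' i : ℕ, if ℓ + 1 ≤ i then (i : ℝ) ^ 2 * v i t else 0) := by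
    refine (hasSum_iff_tendsto_nat_of_nonneg (fun i => ?_) _).2 (hv.m2_unif.tendsto_at ht)
    split_ifs with h
    · exact mul_nonneg (by positivity) (hv.mem i h t ht).1
    · exact le_rfl
  have h' := (hasSum_largeIndex_iff ℓ (fun i : ℕ => (i : ℝ) ^ 2 * v i t) _).1 h
  refine h'.congr_fun fun j => ?_
  push_cast
  ring

lemma IsLargeSolution.continuousOn_m1large {ℓ : ℕ} {T : ℝ} {v : ℕ → ℝ → ℝ}
    (hv : IsLargeSolution ℓ T v) : ContinuousOn (m1large ℓ v) (Set.Icc 0 T) := by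
  refine hv.m1_unif.continuousOn (Frequently.of_forall fun N => continuousOn_finsetSum _ fun i _ => ?_)
  split_ifs with h
  · exact continuousOn_const.mul (hv.contDiff i h).continuousOn
  · exact continuousOn_const

lemma IsPreGelLargeSolution.exists_m2_le {ℓ : ℕ} {T : ℝ} {v : ℕ → ℝ → ℝ}
    (hv : IsPreGelLargeSolution ℓ T v) : ∃ C, ∀ t ∈ Set.Icc 0 T,
      (∑' i : ℕ, if ℓ + 1 ≤ i then (i : ℝ) ^ 2 * v i t else 0) ≤ C := by
  have hc : ContinuousOn (fun t => ∑' i : ℕ, if ℓ + 1 ≤ i then (i : ℝ) ^ 2 * v i t else 0)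
      (Set.Icc 0 T) := by
    refine hv.m2_unif.continuousOn
      (Frequently.of_forall fun N => continuousOn_finsetSum _ fun i _ => ?_)
    split_ifs with h
    · exact continuousOn_const.mul (hv.contDiff i h).continuousOn
    · exact continuousOn_const
  obtain ⟨C, hC⟩ := isCompact_Icc.exists_bound_of_continuousOn hc
  exact ⟨C, fun t ht => (le_abs_self _).trans (hC t ht)⟩

/-- As long as it stays positive, the first moment of a pre-gelation solution decreases at
rate `ℓ`. -/
lemma IsPreGelLargeSolution.m1large_eq_of_pos {ℓ : ℕ} {T s : ℝ} {v : ℕ → ℝ → ℝ}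
    (hv : IsPreGelLargeSolution ℓ T v) (hs : s ∈ Set.Icc 0 T)
    (hpos : ∀ t ∈ Set.Icc 0 s, 0 < m1large ℓ v t) :
    m1large ℓ v s = m1large ℓ v 0 - ℓ * s := by
  have hsub : Set.Icc 0 s ⊆ Set.Icc 0 T := Set.Icc_subset_Icc_right hs.2
  have hμ : ContinuousOn (fun t => 1 / m1large ℓ v t) (Set.Icc 0 s) :=
    continuousOn_const.div (hv.continuousOn_m1large.mono hsub) fun t ht => (hpos t ht).ne'
  obtain ⟨D, hD⟩ := isCompact_Icc.exists_bound_of_continuousOn hμ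
  obtain ⟨C, hC⟩ := hv.exists_m2_le
  have hbal := first_moment_balance (Nat.cast_nonneg (α := ℝ) ℓ) hs.1
    (x := fun j t => ((ℓ : ℝ) + 1 + j) * v (ℓ + 1 + j) t)
    (fun j t ht => mul_nonneg (by positivity) (hv.mem _ (by omega) t (hsub ht)).1)
    hμ (fun t ht => hD t ht)
    (fun j t ht => (hv.hasDerivWithinAt_weighted j (hsub ht)).mono hsub)
    (fun t ht => hv.hasSum_m1large (hsub ht)) (fun t ht => hv.hasSum_m2 (hsub ht))
    (fun t ht => hC t (hsub ht))
  have hcongr : ∀ t ∈ Set.uIcc 0 s,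
      (1 / m1large ℓ v t) ^ 2 * (2 * m1large ℓ v t *
          (∑' i : ℕ, if ℓ + 1 ≤ i then (i : ℝ) ^ 2 * v i t else 0) - ℓ * m1large ℓ v t ^ 2)
        - 2 * (1 / m1large ℓ v t) *
          (∑' i : ℕ, if ℓ + 1 ≤ i then (i : ℝ) ^ 2 * v i t else 0) = -(ℓ : ℝ) := by
    intro t ht
    rw [Set.uIcc_of_le hs.1] at ht
    have := (hpos t ht).ne'
    field_simp
    ring
  rw [intervalIntegral.integral_congr hcongr, intervalIntegral.integral_const,
    smul_eq_mul] at hbal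
  linarith

lemma IsPreGelLargeSolution.m1large_eq {ℓ : ℕ} {T : ℝ} {v : ℕ → ℝ → ℝ}
    (hv : IsPreGelLargeSolution ℓ T v) (hpos : ∀ t ∈ Set.Icc 0 T, 0 < m1large ℓ v 0 - ℓ * t)
    {t : ℝ} (ht : t ∈ Set.Icc 0 T) : m1large ℓ v t = m1large ℓ v 0 - ℓ * t := by
  suffices h : ∀ t ∈ Set.Icc 0 T, 0 < m1large ℓ v t from
    hv.m1large_eq_of_pos ht fun τ hτ => h τ ⟨hτ.1, hτ.2.trans ht.2⟩
  by_contra! hneg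
  have hc := hv.continuousOn_m1large
  have hcomp : IsCompact (Set.Icc 0 T ∩ m1large ℓ v ⁻¹' Set.Iic 0) :=
    isCompact_Icc.of_isClosed_subset (hc.preimage_isClosed_of_isClosed isClosed_Icc isClosed_Iic)
      Set.inter_subset_left
  obtain ⟨t₀, ⟨ht₀, hle⟩, hleast⟩ := hcomp.exists_isLeast hneg
  have hlt : ∀ τ, 0 ≤ τ → τ < t₀ → 0 < m1large ℓ v τ := fun τ h0 hτ => by
    by_contra! h
    exact absurd (hleast ⟨⟨h0, hτ.le.trans ht₀.2⟩, h⟩) (not_le.2 hτ)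
  have hne : (0 : ℝ) ≠ t₀ := by
    rintro rfl
    have := hpos 0 ht₀
    simp only [mul_zero, sub_zero] at this
    exact absurd this (not_lt.2 hle)
  have hEq : Set.EqOn (m1large ℓ v) (fun τ => m1large ℓ v 0 - ℓ * τ) (Set.Ico 0 t₀) :=
    fun τ hτ => hv.m1large_eq_of_pos ⟨hτ.1, hτ.2.le.trans ht₀.2⟩
      fun σ hσ => hlt σ hσ.1 (hσ.2.trans_lt hτ.2)
  have hEq' := hEq.of_subset_closure (t := Set.Icc 0 t₀)
    (hc.mono (Set.Icc_subset_Icc_right ht₀.2)) (by fun_prop) Set.Ico_subset_Icc_self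
    (closure_Ico hne).ge
  have h := hEq' ⟨ht₀.1, le_rfl⟩
  have := hpos t₀ ht₀
  dsimp only at h
  rw [Set.mem_preimage, Set.mem_Iic] at hle
  linarith

lemma one_le_catalan (j : ℕ) : 1 ≤ catalan j := by
  refine Nat.pos_of_ne_zero fun h => ?_
  have := succ_mul_catalan_eq_centralBinom j
  rw [h, mul_zero] at this
  exact (Nat.centralBinom_ne_zero j) this.symm

lemma catalan_le_four_pow (j : ℕ) : catalan j ≤ 4 ^ j := by
  rw [catalan_eq_centralBinom_div]
  refine (Nat.div_le_self _ _).trans ?_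
  rw [Nat.centralBinom_eq_two_mul_choose]
  refine (Nat.choose_le_two_pow _ _).trans_eq ?_
  rw [pow_mul]
  norm_num

/-- Geometric decay of the triangular solution for short times, for finitely supported data. -/
lemma exists_triangularSol_le_geometric {ℓ : ℝ} {μ : ℝ → ℝ} {x0 : ℕ → ℝ} (hℓ : 0 ≤ ℓ)
    (hμ : Continuous μ) (hx0 : ∀ j, 0 ≤ x0 j) {D M : ℝ} {L : ℕ} (hμ0 : ∀ t, 0 ≤ μ t)
    (hμD : ∀ t, μ t ≤ D) (hM : 0 ≤ M) (hxM : ∀ j, x0 j ≤ M) (hxL : ∀ j, L ≤ j → x0 j = 0) :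
    ∃ K lam : ℝ, 0 ≤ K ∧ 0 ≤ lam ∧ ∀ T : ℝ, lam * T ≤ Real.log 2 →
      ∀ j, ∀ t ∈ Set.Icc 0 T, triangularSol ℓ μ x0 j t ≤ K * (1 / 2) ^ j := by
  have hD : 0 ≤ D := (hμ0 0).trans (hμD 0)
  set K := M * 16 ^ L
  have hK : 0 ≤ K := by positivity
  refine ⟨K, (ℓ + 1) * D ^ 2 * K, hK, by positivity, fun T hT j t ht => ?_⟩
  have hinit : ∀ j, x0 j ≤ K * catalan j * (1 / 16) ^ (j + 1) := by
    intro j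
    rcases le_or_gt L j with h | h
    · rw [hxL j h]; positivity
    · have h1 : (1 : ℝ) ≤ catalan j := by exact_mod_cast one_le_catalan j
      have h2 : (1 : ℝ) ≤ 16 ^ L * (1 / 16) ^ (j + 1) := by
        rw [one_div, inv_pow, ← div_eq_mul_inv, one_le_div (by positivity)]
        exact pow_le_pow_right₀ (by norm_num) h
      calc x0 j ≤ M * 1 * 1 := by simpa using hxM j
        _ ≤ M * catalan j * (16 ^ L * (1 / 16) ^ (j + 1)) := by gcongr
        _ = _ := by ring
  refine (triangularSol_le_catalan hℓ hμ hx0 hμ0 hμD hK (by norm_num) hinit j ht.1).trans ?_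
  have hexp : Real.exp ((ℓ + 1) * D ^ 2 * K * t) ≤ 2 := by
    rw [← Real.le_log_iff_exp_le two_pos]
    exact (mul_le_mul_of_nonneg_left ht.2 (by positivity)).trans hT
  have hcat : (catalan j : ℝ) ≤ 4 ^ j := by exact_mod_cast catalan_le_four_pow j
  calc K * catalan j * (1 / 16 * Real.exp ((ℓ + 1) * D ^ 2 * K * t)) ^ (j + 1)
      ≤ K * 4 ^ j * (1 / 16 * 2) ^ (j + 1) := by gcongr
    _ = K * (1 / 2) ^ j * (1 / 8) := by
        rw [pow_succ, ← mul_assoc, mul_assoc K, ← mul_pow]; norm_num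
    _ ≤ K * (1 / 2) ^ j := mul_le_of_le_one_right (by positivity) (by norm_num)

lemma summable_weight_mul_geometric (ℓ K : ℝ) :
    Summable fun j : ℕ => (ℓ + 1 + j) * (K * (1 / 2) ^ j) := by
  have h1 := (summable_geometric_two).mul_left ((ℓ + 1) * K)
  have h2 := (summable_pow_mul_geometric_of_norm_lt_one 1 (r := (1 / 2 : ℝ))
    (by norm_num)).mul_left K
  refine (h1.add h2).congr fun j => ?_
  ring

lemma exists_pos_forall_mul_le (a b c d : ℝ) (hb : 0 < b) (hd : 0 < d) :
    ∃ T : ℝ, 0 < T ∧ a * T ≤ b ∧ c * T < d := by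
  have h1 : ∀ᶠ T in 𝓝[>] (0 : ℝ), a * T < b := by
    refine nhdsWithin_le_nhds (ContinuousAt.eventually_lt (by fun_prop) continuousAt_const ?_)
    simpa using hb
  have h2 : ∀ᶠ T in 𝓝[>] (0 : ℝ), c * T < d := by
    refine nhdsWithin_le_nhds (ContinuousAt.eventually_lt (by fun_prop) continuousAt_const ?_)
    simpa using hd
  obtain ⟨T, ⟨h1, h2⟩, hT⟩ := ((h1.and h2).and self_mem_nhdsWithin).exists
  exact ⟨T, hT, h1.le, h2⟩

/-- The weighted fractions `x j = (ℓ + 1 + j) u_{ℓ + 1 + j}` of a dominated solution of the shifted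
system yield a pre-gelation solution. -/
lemma isPreGelLargeSolution_of_shifted {ℓ : ℕ} {T : ℝ} {x : ℕ → ℝ → ℝ} {μ m : ℝ → ℝ} {b : ℕ → ℝ}
    {u : ℕ → ℝ → ℝ} (hT : 0 ≤ T) (hu : ∀ j t, u (ℓ + 1 + j) t = x j t / ((ℓ : ℝ) + 1 + j))
    (hx : ∀ j, ∀ t ∈ Set.Icc 0 T, 0 ≤ x j t) (hxb : ∀ j, ∀ t ∈ Set.Icc 0 T, x j t ≤ b j)
    (hb : Summable fun j : ℕ => ((ℓ : ℝ) + 1 + j) * b j)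
    (hμ0 : ∀ t ∈ Set.Icc 0 T, 0 ≤ μ t) (hμm : ∀ t ∈ Set.Icc 0 T, μ t * m t = 1)
    (hode : ∀ j : ℕ, ∀ t ∈ Set.Icc 0 T, HasDerivWithinAt (x j)
      (((ℓ : ℝ) + 1 + j) * (μ t ^ 2 * shiftConv (x · t) j - 2 * μ t * x j t)) (Set.Icc 0 T) t)
    (hsmooth : ∀ j, ContDiffOn ℝ 1 (x j) (Set.Icc 0 T))
    (hm : ∀ t ∈ Set.Icc 0 T, HasSum (x · t) (m t))
    (hmass : HasSum (fun j => u (ℓ + 1 + j) 0) 1) : IsPreGelLargeSolution ℓ T u := by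
  have hT0 : (0 : ℝ) ∈ Set.Icc 0 T := ⟨le_rfl, hT⟩
  have hp : ∀ j : ℕ, 0 < (ℓ : ℝ) + 1 + j := fun j => by positivity
  have hp1 : ∀ j : ℕ, 1 ≤ (ℓ : ℝ) + 1 + j := fun j => by
    linarith [Nat.cast_nonneg (α := ℝ) ℓ, Nat.cast_nonneg (α := ℝ) j]
  have hpu : ∀ j t, ((ℓ : ℝ) + 1 + j) * u (ℓ + 1 + j) t = x j t := fun j t => by
    rw [hu, mul_div_cancel₀ _ (hp j).ne']
  have hb0 : ∀ j, 0 ≤ b j := fun j => (hx j 0 hT0).trans (hxb j 0 hT0)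
  have hbs : Summable b :=
    hb.of_nonneg_of_le hb0 fun j => le_mul_of_one_le_left (hb0 j) (hp1 j)
  have hm1 : ∀ t ∈ Set.Icc 0 T, m1large ℓ u t = m t := by
    intro t ht
    refine ((hasSum_largeIndex_iff ℓ (fun i : ℕ => (i : ℝ) * u i t) _).2
      ((hm t ht).congr_fun fun j => ?_)).tsum_eq
    rw [← hpu]
    push_cast
    ring
  have hnonneg : ∀ j, ∀ t ∈ Set.Icc 0 T, 0 ≤ u (ℓ + 1 + j) t := fun j t ht => by
    rw [hu]; exact div_nonneg (hx j t ht) (hp j).le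
  refine ⟨⟨?_, ?_, ?_, ?_⟩, ?_⟩
  · intro n hn t ht
    obtain ⟨j, rfl⟩ := Nat.exists_eq_add_of_le (Nat.succ_le_of_lt hn)
    refine ⟨hnonneg j t ht, ?_⟩
    have h := sum_range_fraction_le (Nat.cast_nonneg ℓ) hT hx hμ0 hμm hode hm (j + 1) ht
    simp only [← hu] at h
    calc u (ℓ + 1 + j) t ≤ ∑ i ∈ range (j + 1), u (ℓ + 1 + i) t :=
          single_le_sum (f := fun i => u (ℓ + 1 + i) t) (fun i _ => hnonneg i t ht)
            (self_mem_range_succ j)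
      _ ≤ _ := h
      _ ≤ 1 := sum_le_hasSum _ (fun i _ => hnonneg i 0 hT0) hmass
  · intro n hn
    obtain ⟨j, rfl⟩ := Nat.exists_eq_add_of_le (Nat.succ_le_of_lt hn)
    exact ((hsmooth j).div_const _).congr fun t _ => hu j t
  · intro n hn t ht
    obtain ⟨j, rfl⟩ := Nat.exists_eq_add_of_le (Nat.succ_le_of_lt hn)
    have h := ((hode j t ht).div_const ((ℓ : ℝ) + 1 + j)).congr
      (fun t _ => hu j t) (hu j t)
    refine h.congr_deriv ?_
    have h1 : 1 / m t = μ t := by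
      rw [eq_comm, eq_div_iff (right_ne_zero_of_mul_eq_one (hμm t ht))]
      exact hμm t ht
    change _ = largeRHS ℓ u (ℓ + 1 + j) t
    rw [largeRHS_eq_shiftConv, hm1 t ht, h1, mul_div_cancel_left₀ _ (hp j).ne']
    simp only [hpu]
  · refine tendstoUniformlyOn_largeIndex (f := fun i t => (i : ℝ) * u i t) hbs fun j t ht => ?_
    have : ((ℓ + 1 + j : ℕ) : ℝ) * u (ℓ + 1 + j) t = x j t := by rw [← hpu]; push_cast; ring
    rw [this, abs_of_nonneg (hx j t ht)]
    exact hxb j t ht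
  · refine tendstoUniformlyOn_largeIndex (f := fun i t => (i : ℝ) ^ 2 * u i t) hb fun j t ht => ?_
    have : ((ℓ + 1 + j : ℕ) : ℝ) ^ 2 * u (ℓ + 1 + j) t = ((ℓ : ℝ) + 1 + j) * x j t := by
      rw [← hpu]; push_cast; ring
    rw [this, abs_of_nonneg (mul_nonneg (hp j).le (hx j t ht))]
    exact mul_le_mul_of_nonneg_left (hxb j t ht) (hp j).le

/-- for `ℓ ≥ 1` and bounded large initial conditions (supported in
`(ℓ, L]`, nonnegative, summing to 1), there is `T > 0` such that on `[0,T]`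
there is exactly one large-cluster solution with these initial conditions which
is also a pre-gelation solution; its cluster fractions are smooth. -/
theorem large_cluster_wellposed (ℓ L : ℕ) (hℓ : 1 ≤ ℓ) (hL : ℓ + 1 ≤ L)
    (u0 : ℕ → ℝ) (h0 : ∀ i, 0 ≤ u0 i)
    (hbdd : ∀ i, L < i → u0 i = 0)
    (hsum : ∑ i ∈ Finset.Icc (ℓ + 1) L, u0 i = 1) :
    ∃ T : ℝ, 0 < T ∧ ∃ u : ℕ → ℝ → ℝ,
      IsPreGelLargeSolution ℓ T u ∧
      (∀ n, ℓ < n → u n 0 = u0 n) ∧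
      (∀ n, ℓ < n → ContDiffOn ℝ (⊤ : ℕ∞) (u n) (Set.Icc 0 T)) ∧
      (∀ n, ℓ < n → ∀ t ∈ Set.Icc (0 : ℝ) T, u n t ∈ Set.Icc (0 : ℝ) 1) ∧
      ∀ v : ℕ → ℝ → ℝ, IsPreGelLargeSolution ℓ T v →
        (∀ n, ℓ < n → v n 0 = u0 n) →
        ∀ n, ℓ < n → Set.EqOn (v n) (u n) (Set.Icc 0 T) := by
  have hp : ∀ j : ℕ, 0 < (ℓ : ℝ) + 1 + j := fun j => by positivity
  have hsupp : ∀ j ∉ range L, u0 (ℓ + 1 + j) = 0 := fun j hj => hbdd _ (by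
    rw [Finset.mem_range] at hj; omega)
  have hmass : HasSum (fun j => u0 (ℓ + 1 + j)) 1 := by
    rw [← hasSum_largeIndex_iff, ← hsum]
    have hif : ∀ i ∈ Finset.Icc (ℓ + 1) L, (if ℓ + 1 ≤ i then u0 i else 0) = u0 i :=
      fun i hi => if_pos (Finset.mem_Icc.1 hi).1
    rw [← sum_congr rfl hif]
    refine hasSum_sum_of_ne_finset_zero fun i hi => ?_
    split_ifs with h
    · exact hbdd i (by rw [Finset.mem_Icc] at hi; omega)
    · rfl
  set x0 : ℕ → ℝ := fun j => ((ℓ : ℝ) + 1 + j) * u0 (ℓ + 1 + j) with hx0def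
  have hx0 : ∀ j, 0 ≤ x0 j := fun j => mul_nonneg (hp j).le (h0 _)
  obtain ⟨M, hM⟩ : ∃ M, HasSum x0 M := ⟨_, hasSum_sum_of_ne_finset_zero (s := range L)
    fun j hj => by simp [hx0def, hsupp j hj]⟩
  have hM0 : 0 < M := by
    refine one_pos.trans_le (hasSum_le (fun j => ?_) hmass hM)
    refine le_mul_of_one_le_left (h0 _) ?_
    linarith [Nat.cast_nonneg (α := ℝ) ℓ, Nat.cast_nonneg (α := ℝ) j]
  set μ : ℝ → ℝ := fun t => 1 / max (M - ℓ * t) (M / 2) with hμdef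
  have hmax : ∀ t, 0 < max (M - ℓ * t) (M / 2) := fun t => lt_max_of_lt_right (half_pos hM0)
  have hμ : Continuous μ := by
    refine continuous_const.div (by fun_prop) fun t => (hmax t).ne'
  have hμ0 : ∀ t, 0 ≤ μ t := fun t => one_div_nonneg.2 (hmax t).le
  have hμD : ∀ t, μ t ≤ 1 / (M / 2) := fun t =>
    one_div_le_one_div_of_le (half_pos hM0) (le_max_right _ _)
  obtain ⟨K, lam, hK, hlam, hgeom⟩ := exists_triangularSol_le_geometric (ℓ := ℓ) (L := L)
    (Nat.cast_nonneg ℓ) hμ hx0 hμ0 hμD hM0.le (fun j => le_hasSum hM j fun i _ => hx0 i)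
    (fun j hj => by simp [hx0def, hsupp j (by simpa using hj)])
  have hb := summable_weight_mul_geometric ℓ K
  set G := (1 / (M / 2)) ^ 2 * (2 * (∑' j : ℕ, ((ℓ : ℝ) + 1 + j) * (K * (1 / 2) ^ j)) +
    ℓ * ((∑' j : ℕ, ((ℓ : ℝ) + 1 + j) * (K * (1 / 2) ^ j)) + M))
  have hG0 : 0 ≤ G := by
    have : 0 ≤ ∑' j : ℕ, ((ℓ : ℝ) + 1 + j) * (K * (1 / 2) ^ j) :=
      tsum_nonneg fun j => mul_nonneg (hp j).le (by positivity)
    positivity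
  obtain ⟨T, hT, hT1, hT2⟩ := exists_pos_forall_mul_le (lam / Real.log 2 + ℓ / (M / 2)) 1 G 1
    one_pos one_pos
  have hlog : 0 < Real.log 2 := Real.log_pos one_lt_two
  have hT3 : lam * T ≤ Real.log 2 := by
    have h1 : lam / Real.log 2 * T ≤ 1 := by
      have : 0 ≤ ℓ / (M / 2) * T := by positivity
      linarith
    rwa [div_mul_eq_mul_div, div_le_one hlog] at h1
  have hT4 : ℓ * T ≤ M / 2 := by
    have h1 : ℓ / (M / 2) * T ≤ 1 := by
      have : 0 ≤ lam / Real.log 2 * T := by positivity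
      linarith
    rwa [div_mul_eq_mul_div, div_le_one (half_pos hM0)] at h1
  have hMt : ∀ t ∈ Set.Icc 0 T, M / 2 ≤ M - ℓ * t := fun t ht => by
    linarith [mul_le_mul_of_nonneg_left ht.2 (Nat.cast_nonneg (α := ℝ) ℓ)]
  have hMpos : ∀ t ∈ Set.Icc 0 T, 0 < M - ℓ * t := fun t ht => (half_pos hM0).trans_le (hMt t ht)
  have hμeq : ∀ t ∈ Set.Icc 0 T, μ t = 1 / (M - ℓ * t) := fun t ht => by
    simp only [hμdef, max_eq_left (hMt t ht)]
  have hμM : ∀ t ∈ Set.Icc 0 T, μ t * (M - ℓ * t) = 1 := fun t ht => by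
    rw [hμeq t ht, one_div_mul_cancel (hMpos t ht).ne']
  have hμs : ContDiffOn ℝ (⊤ : ℕ∞) μ (Set.Icc 0 T) :=
    (contDiffOn_const.div (by fun_prop) fun t ht => (hMpos t ht).ne').congr hμeq
  set x := triangularSol ℓ μ x0
  have hx : ∀ j, ∀ t ∈ Set.Icc 0 T, 0 ≤ x j t := fun j t ht =>
    triangularSol_nonneg (Nat.cast_nonneg ℓ) hx0 j ht.1
  have hode : ∀ j : ℕ, ∀ t ∈ Set.Icc 0 T, HasDerivWithinAt (x j)
      (((ℓ : ℝ) + 1 + j) * (μ t ^ 2 * shiftConv (x · t) j - 2 * μ t * x j t))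
      (Set.Icc 0 T) t := fun j t _ => (hasDerivAt_triangularSol hμ j t).hasDerivWithinAt
  have hmom : ∀ t ∈ Set.Icc 0 T, HasSum (x · t) (M - ℓ * t) := by
    refine hasSum_first_moment_of_dominated (Nat.cast_nonneg ℓ) hT.le hx (hgeom T hT3) hb
      (fun t ht => (hMpos t ht).le) hμ.continuousOn
      (fun t _ => (abs_of_nonneg (hμ0 t)).trans_le (hμD t)) hμM hode ?_ hT2
    exact hM.congr_fun fun j => triangularSol_zero _ _ _ j
  have hsmooth : ∀ j, ContDiffOn ℝ (⊤ : ℕ∞) (x j) (Set.Icc 0 T) :=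
    contDiffOn_triangularSol hμ hT hμs
  set u : ℕ → ℝ → ℝ := fun n t => x (n - (ℓ + 1)) t / n with hudef
  have hu : ∀ j t, u (ℓ + 1 + j) t = x j t / ((ℓ : ℝ) + 1 + j) := fun j t => by
    simp [hudef]
  have hu0 : ∀ j, u (ℓ + 1 + j) 0 = u0 (ℓ + 1 + j) := fun j => by
    rw [hu, show x j 0 = x0 j from triangularSol_zero _ _ _ j]
    exact mul_div_cancel_left₀ _ (hp j).ne'
  have hsol : IsPreGelLargeSolution ℓ T u :=
    isPreGelLargeSolution_of_shifted hT.le hu hx (hgeom T hT3) hb (fun t _ => hμ0 t) hμM hode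
      (fun j => (hsmooth j).of_le (by exact_mod_cast le_top)) hmom
      (hmass.congr_fun hu0)
  refine ⟨T, hT, u, hsol, ?_, ?_, hsol.mem, ?_⟩
  · intro n hn
    obtain ⟨j, rfl⟩ := Nat.exists_eq_add_of_le (Nat.succ_le_of_lt hn)
    exact hu0 j
  · intro n hn
    obtain ⟨j, rfl⟩ := Nat.exists_eq_add_of_le (Nat.succ_le_of_lt hn)
    exact ((hsmooth j).div_const _).congr fun t _ => hu j t
  · intro v hv hv0 n hn t ht
    obtain ⟨j, rfl⟩ := Nat.exists_eq_add_of_le (Nat.succ_le_of_lt hn)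
    have hvx0 : ∀ j : ℕ, ((ℓ : ℝ) + 1 + j) * v (ℓ + 1 + j) 0 = x0 j := fun j => by
      rw [hv0 _ (by omega)]
    have hvM : m1large ℓ v 0 = M :=
      (hv.hasSum_m1large ⟨le_rfl, hT.le⟩).unique (hM.congr_fun hvx0)
    have hvm : ∀ t ∈ Set.Icc 0 T, m1large ℓ v t = M - ℓ * t := fun t ht => by
      have h := hv.m1large_eq (by rwa [hvM]) ht
      rwa [hvM] at h
    have heq := eqOn_triangularSol (ℓ := ℓ) hμ hvx0 (fun i t ht => by
      have h := hv.hasDerivWithinAt_weighted i ht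
      rwa [hvm t ht, ← hμeq t ht] at h) j ht
    change v (ℓ + 1 + j) t = u (ℓ + 1 + j) t
    rw [hu, eq_div_iff (hp j).ne', mul_comm]
    exact heq
end
end

section
/- Let ℓ ≥ 1, L ≥ ℓ+1, and N ≥ 2L+ℓ, and consider the truncated system with bounded large initial data. Let T₁ = ℓ/(2(ℓ+1)). Then the truncated system has a unique solution u^(N) on [0,T₁], this solution is nonnegative, and for all t ∈ [0,T₁] it satisfies m₀^(N)(t) = 1 − t, m₁^(N)(t) = m₁^(N)(0) − ℓ t, and M^(N)(t) ≥ 1. -/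
open Finset Filter Topology

noncomputable section

/-- Total reaction probability mass for the truncated system:
`M^(N)(t) = ∑_{j=ℓ+1}^{N−1} ∑_{k=ℓ+1}^{N−j+ℓ} j k u_j(t) u_k(t)`. -/
def MNfun (ℓ N : ℕ) (u : ℕ → ℝ → ℝ) (t : ℝ) : ℝ :=
  ∑ j ∈ Finset.Icc (ℓ + 1) (N - 1), ∑ k ∈ Finset.Icc (ℓ + 1) (N - j + ℓ),
    (j : ℝ) * (k : ℝ) * u j t * u k t

/-- Right-hand side of the truncated system for `u n` (`ℓ+1 ≤ n ≤ N`). -/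
def truncRHS (ℓ N : ℕ) (u : ℕ → ℝ → ℝ) (n : ℕ) (t : ℝ) : ℝ :=
  if n = ℓ + 1 then
    -(2 * ((ℓ : ℝ) + 1) * u (ℓ + 1) t / MNfun ℓ N u t) *
      ∑ k ∈ Finset.Icc (ℓ + 1) (N - 1), (k : ℝ) * u k t
  else if n = N then
    (1 / MNfun ℓ N u t) *
      ∑ k ∈ Finset.Icc (ℓ + 1) (N - 1),
        (k : ℝ) * ((N - k + ℓ : ℕ) : ℝ) * u k t * u (N - k + ℓ) t
  else
    (1 / MNfun ℓ N u t) *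
      ((∑ k ∈ Finset.Icc (ℓ + 1) (n - 1),
          (k : ℝ) * ((n - k + ℓ : ℕ) : ℝ) * u k t * u (n - k + ℓ) t)
        - 2 * (n : ℝ) * u n t *
            ∑ k ∈ Finset.Icc (ℓ + 1) (N - n + ℓ), (k : ℝ) * u k t)

/-- `u` is a (C¹) solution of the truncated system on `[0,T]` with
initial data `u0`. -/
structure IsTruncSolution (ℓ N : ℕ) (T : ℝ) (u0 : ℕ → ℝ) (u : ℕ → ℝ → ℝ) :
    Prop where
  contDiff : ∀ n ∈ Finset.Icc (ℓ + 1) N, ContDiffOn ℝ 1 (u n) (Set.Icc 0 T)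
  init : ∀ n ∈ Finset.Icc (ℓ + 1) N, u n 0 = u0 n
  ode : ∀ n ∈ Finset.Icc (ℓ + 1) N, ∀ t ∈ Set.Icc (0 : ℝ) T,
    HasDerivWithinAt (u n) (truncRHS ℓ N u n t) (Set.Icc 0 T) t

/-- The gain term in the equation for the `n`-th component. -/
def truncGain (ℓ n : ℕ) (w : ℕ → ℝ) : ℝ :=
  ∑ k ∈ Finset.Icc (ℓ + 1) (n - 1), (k : ℝ) * ((n - k + ℓ : ℕ) : ℝ) * w k * w (n - k + ℓ)

/-- The unnormalised loss term in the equation for the `n`-th component, without the factor `2`. -/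
def truncLoss (ℓ N n : ℕ) (w : ℕ → ℝ) : ℝ :=
  (n : ℝ) * w n * ∑ k ∈ Finset.Icc (ℓ + 1) (N - n + ℓ), (k : ℝ) * w k

/-- The unnormalised right-hand side of the truncated system. -/
def truncFlux (ℓ N n : ℕ) (w : ℕ → ℝ) : ℝ :=
  truncGain ℓ n w - 2 * truncLoss ℓ N n w

/-- The normalising factor `M^(N)` as a function of the state. -/
def truncMass (ℓ N : ℕ) (w : ℕ → ℝ) : ℝ :=
  ∑ j ∈ Finset.Icc (ℓ + 1) (N - 1), ∑ k ∈ Finset.Icc (ℓ + 1) (N - j + ℓ),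
    (j : ℝ) * (k : ℝ) * w j * w k

/-- Clamp every component to `[0, 1]`. -/
def clampUnit {ι : Type*} (w : ι → ℝ) (i : ι) : ℝ := max 0 (min (w i) 1)

/-- Extend a family indexed by a finite set of naturals by zero. -/
def extendZero (s : Finset ℕ) (x : s → ℝ) (n : ℕ) : ℝ :=
  if h : n ∈ s then x ⟨n, h⟩ else 0

theorem MNfun_eq_truncMass (ℓ N : ℕ) (u : ℕ → ℝ → ℝ) (t : ℝ) :
    MNfun ℓ N u t = truncMass ℓ N (fun n => u n t) := rfl

theorem truncRHS_eq {ℓ N n : ℕ} (hn : n ∈ Finset.Icc (ℓ + 1) N) (u : ℕ → ℝ → ℝ)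
    (t : ℝ) :
    truncRHS ℓ N u n t =
      truncFlux ℓ N n (fun n => u n t) / truncMass ℓ N (fun n => u n t) := by
  rw [Finset.mem_Icc] at hn
  rw [truncRHS, MNfun_eq_truncMass, truncFlux, truncGain, truncLoss]
  split_ifs with h1 h2
  · subst h1
    have e : N - (ℓ + 1) + ℓ = N - 1 := by omega
    simp [e]
    ring
  · subst h2
    simp
    ring
  · ring

theorem truncFlux_congr {ℓ N n : ℕ} (hn : n ∈ Finset.Icc (ℓ + 1) N) {w z : ℕ → ℝ}
    (h : ∀ k ∈ Finset.Icc (ℓ + 1) N, w k = z k) : truncFlux ℓ N n w = truncFlux ℓ N n z := by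
  have hn' := Finset.mem_Icc.1 hn
  unfold truncFlux truncGain truncLoss
  rw [h n hn]
  congr 1
  · refine Finset.sum_congr rfl fun k hk => ?_
    rw [Finset.mem_Icc] at hk
    rw [h k (Finset.mem_Icc.2 ⟨by omega, by omega⟩),
      h (n - k + ℓ) (Finset.mem_Icc.2 ⟨by omega, by omega⟩)]
  · congr 2
    refine Finset.sum_congr rfl fun k hk => ?_
    rw [Finset.mem_Icc] at hk
    rw [h k (Finset.mem_Icc.2 ⟨by omega, by omega⟩)]

theorem truncMass_congr {ℓ N : ℕ} {w z : ℕ → ℝ}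
    (h : ∀ k ∈ Finset.Icc (ℓ + 1) N, w k = z k) : truncMass ℓ N w = truncMass ℓ N z := by
  refine Finset.sum_congr rfl fun j hj => Finset.sum_congr rfl fun k hk => ?_
  rw [Finset.mem_Icc] at hj hk
  rw [h k (Finset.mem_Icc.2 ⟨by omega, by omega⟩), h j (Finset.mem_Icc.2 ⟨by omega, by omega⟩)]

section Moments

variable {ℓ N : ℕ}

theorem sum_mul_truncGain (φ : ℕ → ℝ) (w : ℕ → ℝ) :
    ∑ n ∈ Finset.Icc (ℓ + 1) N, φ n * truncGain ℓ n w =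
      ∑ j ∈ Finset.Icc (ℓ + 1) (N - 1), ∑ k ∈ Finset.Icc (ℓ + 1) (N - j + ℓ),
        φ (j + k - ℓ) * ((j : ℝ) * (k : ℝ) * w j * w k) := by
  simp_rw [truncGain, Finset.mul_sum]
  rw [Finset.sum_sigma', Finset.sum_sigma']
  refine Finset.sum_bij' (fun p _ => ⟨p.2, p.1 - p.2 + ℓ⟩) (fun p _ => ⟨p.1 + p.2 - ℓ, p.1⟩)
    ?_ ?_ ?_ ?_ ?_
  · rintro ⟨n, k⟩ h
    simp only [Finset.mem_sigma, Finset.mem_Icc] at h ⊢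
    omega
  · rintro ⟨n, k⟩ h
    simp only [Finset.mem_sigma, Finset.mem_Icc] at h ⊢
    omega
  · rintro ⟨n, k⟩ h
    simp only [Finset.mem_sigma, Finset.mem_Icc] at h
    simp only [Sigma.mk.injEq, heq_eq_eq, and_true]
    omega
  · rintro ⟨n, k⟩ h
    simp only [Finset.mem_sigma, Finset.mem_Icc] at h
    simp only [Sigma.mk.injEq, heq_eq_eq, true_and]
    omega
  · rintro ⟨n, k⟩ h
    simp only [Finset.mem_sigma, Finset.mem_Icc] at h
    have e : k + (n - k + ℓ) - ℓ = n := by omega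
    simp only [e]

theorem sum_mul_truncLoss (hN : 1 ≤ N) (φ : ℕ → ℝ) (w : ℕ → ℝ) :
    ∑ n ∈ Finset.Icc (ℓ + 1) N, φ n * truncLoss ℓ N n w =
      ∑ j ∈ Finset.Icc (ℓ + 1) (N - 1), ∑ k ∈ Finset.Icc (ℓ + 1) (N - j + ℓ),
        φ j * ((j : ℝ) * (k : ℝ) * w j * w k) := by
  rw [← Finset.sum_subset (Finset.Icc_subset_Icc_right (Nat.sub_le N 1))]
  · refine Finset.sum_congr rfl fun j _ => ?_
    rw [truncLoss, Finset.mul_sum, Finset.mul_sum]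
    exact Finset.sum_congr rfl fun k _ => by ring
  · intro n hn hn'
    simp only [Finset.mem_Icc] at hn hn'
    obtain rfl : n = N := by omega
    simp [truncLoss]

theorem sum_truncLoss (hN : 1 ≤ N) (w : ℕ → ℝ) :
    ∑ n ∈ Finset.Icc (ℓ + 1) N, truncLoss ℓ N n w = truncMass ℓ N w := by
  simpa [truncMass] using sum_mul_truncLoss (ℓ := ℓ) hN (fun _ => 1) w

theorem sum_truncFlux (hN : 1 ≤ N) (w : ℕ → ℝ) :
    ∑ n ∈ Finset.Icc (ℓ + 1) N, truncFlux ℓ N n w = -truncMass ℓ N w := by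
  have h := sum_mul_truncGain (ℓ := ℓ) (N := N) (fun _ => 1) w
  simp only [one_mul] at h
  simp_rw [truncFlux, Finset.sum_sub_distrib, ← Finset.mul_sum, sum_truncLoss hN, h, truncMass]
  ring

theorem sum_mul_truncFlux (hN : 1 ≤ N) (w : ℕ → ℝ) :
    ∑ n ∈ Finset.Icc (ℓ + 1) N, (n : ℝ) * truncFlux ℓ N n w = -(ℓ * truncMass ℓ N w) := by
  have hg := sum_mul_truncGain (ℓ := ℓ) (N := N) (fun n => (n : ℝ)) w
  have hl := sum_mul_truncLoss (ℓ := ℓ) hN (fun n => (n : ℝ)) w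
  have hs : ∑ j ∈ Finset.Icc (ℓ + 1) (N - 1), ∑ k ∈ Finset.Icc (ℓ + 1) (N - j + ℓ),
        (j : ℝ) * ((j : ℝ) * (k : ℝ) * w j * w k) =
      ∑ j ∈ Finset.Icc (ℓ + 1) (N - 1), ∑ k ∈ Finset.Icc (ℓ + 1) (N - j + ℓ),
        (k : ℝ) * ((j : ℝ) * (k : ℝ) * w j * w k) := by
    rw [Finset.sum_comm' (t' := Finset.Icc (ℓ + 1) (N - 1))
      (s' := fun j => Finset.Icc (ℓ + 1) (N - j + ℓ))]
    · exact Finset.sum_congr rfl fun j _ => Finset.sum_congr rfl fun k _ => by ring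
    · intro j k
      simp only [Finset.mem_Icc]
      omega
  have e : ∑ n ∈ Finset.Icc (ℓ + 1) N, (n : ℝ) * truncFlux ℓ N n w =
      ∑ n ∈ Finset.Icc (ℓ + 1) N, (n : ℝ) * truncGain ℓ n w -
        2 * ∑ n ∈ Finset.Icc (ℓ + 1) N, (n : ℝ) * truncLoss ℓ N n w := by
    rw [Finset.mul_sum, ← Finset.sum_sub_distrib]
    exact Finset.sum_congr rfl fun n _ => by rw [truncFlux]; ring
  rw [e, hl, two_mul]
  nth_rewrite 2 [hs]
  rw [hg, truncMass, Finset.mul_sum, ← Finset.sum_add_distrib, ← Finset.sum_sub_distrib,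
    ← Finset.sum_neg_distrib]
  refine Finset.sum_congr rfl fun j hj => ?_
  rw [Finset.mul_sum, ← Finset.sum_add_distrib, ← Finset.sum_sub_distrib,
    ← Finset.sum_neg_distrib]
  refine Finset.sum_congr rfl fun k hk => ?_
  rw [Finset.mem_Icc] at hj hk
  rw [Nat.cast_sub (by omega), Nat.cast_add]
  ring

theorem truncGain_nonneg {w : ℕ → ℝ} (hw : ∀ n, 0 ≤ w n) (n : ℕ) : 0 ≤ truncGain ℓ n w :=
  Finset.sum_nonneg fun k _ =>
    mul_nonneg (mul_nonneg (by positivity) (hw k)) (hw _)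

theorem truncLoss_nonneg {w : ℕ → ℝ} (hw : ∀ n, 0 ≤ w n) (n : ℕ) : 0 ≤ truncLoss ℓ N n w :=
  mul_nonneg (mul_nonneg (by positivity) (hw n))
    (Finset.sum_nonneg fun k _ => mul_nonneg (by positivity) (hw k))

theorem truncMass_nonneg {w : ℕ → ℝ} (hw : ∀ n, 0 ≤ w n) : 0 ≤ truncMass ℓ N w :=
  Finset.sum_nonneg fun j _ => Finset.sum_nonneg fun k _ =>
    mul_nonneg (mul_nonneg (by positivity) (hw j)) (hw k)

theorem neg_two_mul_truncMass_le_sum_truncFlux {L : ℕ} (hN : 1 ≤ N) (hL : L ≤ N) {w : ℕ → ℝ}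
    (hw : ∀ n, 0 ≤ w n) :
    -(2 * truncMass ℓ N w) ≤ ∑ n ∈ Finset.Icc (ℓ + 1) L, truncFlux ℓ N n w := by
  have h1 : ∑ n ∈ Finset.Icc (ℓ + 1) L, truncLoss ℓ N n w ≤ truncMass ℓ N w := by
    rw [← sum_truncLoss hN]
    exact Finset.sum_le_sum_of_subset_of_nonneg (Finset.Icc_subset_Icc_right hL)
      fun n _ _ => truncLoss_nonneg hw n
  have h2 : 0 ≤ ∑ n ∈ Finset.Icc (ℓ + 1) L, truncGain ℓ n w :=
    Finset.sum_nonneg fun n _ => truncGain_nonneg hw n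
  simp_rw [truncFlux, Finset.sum_sub_distrib, ← Finset.mul_sum]
  linarith

theorem sq_sum_le_truncMass {L : ℕ} (hL : ℓ + 1 ≤ L) (hN : 2 * L ≤ N + ℓ) {w : ℕ → ℝ}
    (hw : ∀ n, 0 ≤ w n) :
    (((ℓ : ℝ) + 1) * ∑ n ∈ Finset.Icc (ℓ + 1) L, w n) ^ 2 ≤ truncMass ℓ N w := by
  have h1 : ((ℓ : ℝ) + 1) * ∑ n ∈ Finset.Icc (ℓ + 1) L, w n ≤
      ∑ n ∈ Finset.Icc (ℓ + 1) L, (n : ℝ) * w n := by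
    rw [Finset.mul_sum]
    refine Finset.sum_le_sum fun n hn => mul_le_mul_of_nonneg_right ?_ (hw n)
    exact_mod_cast (Finset.mem_Icc.1 hn).1
  have h0 : 0 ≤ ((ℓ : ℝ) + 1) * ∑ n ∈ Finset.Icc (ℓ + 1) L, w n :=
    mul_nonneg (by positivity) (Finset.sum_nonneg fun n _ => hw n)
  refine (pow_le_pow_left₀ h0 h1 2).trans ?_
  rw [sq, Finset.sum_mul_sum, truncMass]
  have hnn : ∀ j k : ℕ, 0 ≤ (j : ℝ) * (k : ℝ) * w j * w k := fun j k =>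
    mul_nonneg (mul_nonneg (by positivity) (hw j)) (hw k)
  calc
    _ = ∑ j ∈ Finset.Icc (ℓ + 1) L, ∑ k ∈ Finset.Icc (ℓ + 1) L,
        (j : ℝ) * (k : ℝ) * w j * w k :=
      Finset.sum_congr rfl fun j _ => Finset.sum_congr rfl fun k _ => by ring
    _ ≤ ∑ j ∈ Finset.Icc (ℓ + 1) L, ∑ k ∈ Finset.Icc (ℓ + 1) (N - j + ℓ),
        (j : ℝ) * (k : ℝ) * w j * w k := by
      refine Finset.sum_le_sum fun j hj => ?_
      rw [Finset.mem_Icc] at hj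
      exact Finset.sum_le_sum_of_subset_of_nonneg (Finset.Icc_subset_Icc_right (by omega))
        fun k _ _ => hnn j k
    _ ≤ _ := Finset.sum_le_sum_of_subset_of_nonneg (Finset.Icc_subset_Icc_right (by omega))
        fun j _ _ => Finset.sum_nonneg fun k _ => hnn j k

end Moments

section Scalar

theorem HasDerivWithinAt.Ici_of_Icc {E : Type*} [NormedAddCommGroup E] [NormedSpace ℝ E]
    {f : ℝ → E} {f' : E} {a b t : ℝ} (h : HasDerivWithinAt f f' (Set.Icc a b) t)
    (ht : t ∈ Set.Ico a b) : HasDerivWithinAt f f' (Set.Ici t) t :=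
  h.mono_of_mem_nhdsWithin (Icc_mem_nhdsGE_of_mem ht)

/-- A function whose derivative is nonnegative wherever the function is negative stays
nonnegative. -/
theorem nonneg_of_deriv_nonneg_of_neg {f f' : ℝ → ℝ} {T : ℝ}
    (hf : ∀ t ∈ Set.Icc 0 T, HasDerivWithinAt f (f' t) (Set.Icc 0 T) t) (h0 : 0 ≤ f 0)
    (hneg : ∀ t ∈ Set.Icc 0 T, f t < 0 → 0 ≤ f' t) : ∀ t ∈ Set.Icc 0 T, 0 ≤ f t := by
  intro t ht
  have key : ∀ ε > 0, -f t ≤ ε * (1 + t) := by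
    intro ε hε
    refine image_le_of_deriv_right_lt_deriv_boundary (f := fun t => -f t) (f' := fun t => -f' t)
      (B := fun t => ε * (1 + t)) (B' := fun _ => ε) (a := 0) (b := T)
      (fun x hx => (hf x hx).continuousWithinAt.neg)
      (fun x hx => ((hf x (Set.Ico_subset_Icc_self hx)).Ici_of_Icc hx).neg) ?_ ?_ ?_ ht
    · simp only [add_zero, mul_one]
      linarith
    · intro x
      simpa using ((hasDerivAt_id x).const_add 1).const_mul ε
    · intro x hx hfx
      have hpos : 0 < ε * (1 + x) := mul_pos hε (by linarith [hx.1])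
      have := hneg x (Set.Ico_subset_Icc_self hx) (by linarith)
      linarith
  by_contra! hlt
  have ht1 : 0 < 1 + t := by linarith [ht.1]
  have := key (-f t / (2 * (1 + t))) (div_pos (by linarith) (by positivity))
  have e : -f t / (2 * (1 + t)) * (1 + t) = -f t / 2 := by field_simp
  linarith

theorem le_add_mul_of_deriv_le {f f' : ℝ → ℝ} {T c : ℝ}
    (hf : ∀ t ∈ Set.Icc 0 T, HasDerivWithinAt f (f' t) (Set.Icc 0 T) t)
    (hle : ∀ t ∈ Set.Icc 0 T, f' t ≤ c) : ∀ t ∈ Set.Icc 0 T, f t ≤ f 0 + c * t := by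
  intro t ht
  refine image_le_of_deriv_right_le_deriv_boundary (f := f) (f' := f')
    (B := fun t => f 0 + c * t) (B' := fun _ => c) (a := 0) (b := T)
    (fun x hx => (hf x hx).continuousWithinAt)
    (fun x hx => (hf x (Set.Ico_subset_Icc_self hx)).Ici_of_Icc hx) (by simp) (by fun_prop) ?_
    (fun x hx => hle x (Set.Ico_subset_Icc_self hx)) ht
  intro x _
  simpa using (((hasDerivAt_id x).const_mul c).const_add (f 0)).hasDerivWithinAt

theorem add_mul_le_of_le_deriv {f f' : ℝ → ℝ} {T c : ℝ}
    (hf : ∀ t ∈ Set.Icc 0 T, HasDerivWithinAt f (f' t) (Set.Icc 0 T) t)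
    (hle : ∀ t ∈ Set.Icc 0 T, c ≤ f' t) : ∀ t ∈ Set.Icc 0 T, f 0 + c * t ≤ f t := by
  intro t ht
  have := le_add_mul_of_deriv_le (f := fun t => -f t) (f' := fun t => -f' t) (c := -c)
    (fun t ht => (hf t ht).neg) (fun t ht => neg_le_neg (hle t ht)) t ht
  linarith

end Scalar

section AbstractODE

variable {E : Type*} [NormedAddCommGroup E] [NormedSpace ℝ E]

open scoped NNReal in
theorem exists_solution_of_lipschitzWith_of_bounded [CompleteSpace E] {F : E → E} {K C : ℝ≥0}
    (hF : LipschitzWith K F) (hC : ∀ x, ‖F x‖ ≤ C) (x₀ : E) {T : ℝ} (hT : 0 ≤ T) :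
    ∃ α : ℝ → E, α 0 = x₀ ∧
      ∀ t ∈ Set.Icc 0 T, HasDerivWithinAt α (F (α t)) (Set.Icc 0 T) t := by
  have h : IsPicardLindelof (fun _ => F) (tmin := 0) (tmax := T) ⟨0, le_rfl, hT⟩ x₀
      (C * T.toNNReal) 0 C K := by
    refine IsPicardLindelof.of_time_independent (fun x _ => hC x) hF.lipschitzOnWith ?_
    simp [hT]
  exact h.exists_eq_forall_mem_Icc_hasDerivWithinAt₀

/-- Uniqueness for an autonomous equation whose vector field is `C¹` along one of the solutions. -/
theorem eqOn_of_contDiffAt_along {F : E → E} {α β : ℝ → E} {T : ℝ}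
    (hα : ∀ t ∈ Set.Icc 0 T, HasDerivWithinAt α (F (α t)) (Set.Icc 0 T) t)
    (hβ : ∀ t ∈ Set.Icc 0 T, HasDerivWithinAt β (F (β t)) (Set.Icc 0 T) t)
    (h0 : β 0 = α 0) (hF : ∀ t ∈ Set.Icc 0 T, ContDiffAt ℝ 1 F (α t)) :
    Set.EqOn β α (Set.Icc 0 T) := by
  have hαc : ContinuousOn α (Set.Icc 0 T) := fun t ht => (hα t ht).continuousWithinAt
  have hβc : ContinuousOn β (Set.Icc 0 T) := fun t ht => (hβ t ht).continuousWithinAt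
  have hclosed : IsClosed ({t | β t = α t} ∩ Set.Icc 0 T) := by
    have := (hβc.prodMk hαc).preimage_isClosed_of_isClosed isClosed_Icc isClosed_diagonal
    convert this using 1
    ext t
    simp [and_comm]
  refine hclosed.Icc_subset_of_forall_mem_nhdsWithin h0 ?_
  rintro t ⟨hteq, ht⟩
  obtain ⟨K, s, hs, hK⟩ := (hF t (Set.Ico_subset_Icc_self ht)).exists_lipschitzOnWith
  have hmem : Set.Icc 0 T ∈ 𝓝[≥] t := Icc_mem_nhdsGE_of_mem ht
  have hαt : Tendsto α (𝓝[≥] t) (𝓝 (α t)) :=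
    (hαc t (Set.Ico_subset_Icc_self ht)).mono_of_mem_nhdsWithin hmem
  have hβt : Tendsto β (𝓝[≥] t) (𝓝 (α t)) := by
    have := (hβc t (Set.Ico_subset_Icc_self ht)).mono_of_mem_nhdsWithin hmem
    rwa [ContinuousWithinAt, show β t = α t from hteq] at this
  have hall : ∀ᶠ x in 𝓝[≥] t, α x ∈ s ∧ β x ∈ s ∧ x ∈ Set.Icc 0 T :=
    (hαt.eventually hs).and ((hβt.eventually hs).and hmem)
  obtain ⟨b, hb, hsub⟩ := (mem_nhdsGE_iff_exists_Icc_subset (a := t)).1 hall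
  have hb' : t < b := hb
  have hIco : ∀ x ∈ Set.Ico t b, x ∈ Set.Ico 0 T := fun x hx =>
    ⟨ht.1.trans hx.1, hx.2.trans_le (hsub ⟨hb'.le, le_rfl⟩).2.2.2⟩
  have key : Set.EqOn β α (Set.Icc t b) :=
    ODE_solution_unique_of_mem_Icc_right (v := fun _ => F) (s := fun _ => s) (K := K)
      (fun _ _ => hK) (hβc.mono fun x hx => (hsub hx).2.2)
      (fun x hx => (hβ x (Set.Ico_subset_Icc_self (hIco x hx))).Ici_of_Icc (hIco x hx))
      (fun x hx => (hsub (Set.Ico_subset_Icc_self hx)).2.1)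
      (hαc.mono fun x hx => (hsub hx).2.2)
      (fun x hx => (hα x (Set.Ico_subset_Icc_self (hIco x hx))).Ici_of_Icc (hIco x hx))
      (fun x hx => (hsub (Set.Ico_subset_Icc_self hx)).1) hteq
  exact mem_of_superset (Icc_mem_nhdsGT hb') key

end AbstractODE

section Clamp

variable {ι : Type*}

theorem clampUnit_nonneg (w : ι → ℝ) (i : ι) : 0 ≤ clampUnit w i := le_max_left _ _

theorem clampUnit_le_one (w : ι → ℝ) (i : ι) : clampUnit w i ≤ 1 :=
  max_le zero_le_one (min_le_right _ _)

theorem clampUnit_of_mem {w : ι → ℝ} {i : ι} (h0 : 0 ≤ w i) (h1 : w i ≤ 1) :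
    clampUnit w i = w i := by
  rw [clampUnit, min_eq_left h1, max_eq_right h0]

theorem clampUnit_of_nonpos {w : ι → ℝ} {i : ι} (h : w i ≤ 0) : clampUnit w i = 0 := by
  rw [clampUnit, max_eq_left ((min_le_left _ _).trans h)]

theorem lipschitzWith_clampUnit [Fintype ι] :
    LipschitzWith 1 (clampUnit : (ι → ℝ) → ι → ℝ) :=
  LipschitzWith.of_dist_le_mul fun x y => by
    rw [dist_pi_le_iff (by positivity)]
    intro i
    have h : LipschitzWith 1 fun a : ℝ => max 0 (min a 1) :=
      (LipschitzWith.id.min_const 1).const_max 0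
    exact (h.dist_le_mul _ _).trans
      (mul_le_mul_of_nonneg_left (dist_le_pi_dist x y i) (by positivity))

theorem extendZero_of_mem {s : Finset ℕ} (x : s → ℝ) {n : ℕ} (h : n ∈ s) :
    extendZero s x n = x ⟨n, h⟩ := dif_pos h

theorem extendZero_clampUnit (s : Finset ℕ) (x : s → ℝ) :
    extendZero s (clampUnit x) = clampUnit (extendZero s x) := by
  ext n
  by_cases h : n ∈ s <;> simp [extendZero, clampUnit, h]

@[fun_prop]
theorem contDiff_extendZero (s : Finset ℕ) (n : ℕ) :
    ContDiff ℝ 1 fun x : s → ℝ => extendZero s x n := by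
  unfold extendZero
  split_ifs with h <;> fun_prop

end Clamp

section VectorField

open scoped NNReal in
/-- Normalising a `C¹` vector field by the maximum of a `C¹` function and `1`, after composition
with a Lipschitz map into a convex compact set, gives a bounded Lipschitz vector field. -/
theorem exists_lipschitzWith_smul_comp {V W : Type*} [NormedAddCommGroup V] [NormedSpace ℝ V]
    [NormedAddCommGroup W] [NormedSpace ℝ W] {Q : Set V} (hQ : IsCompact Q) (hQc : Convex ℝ Q)
    {c : V → V} {A : ℝ≥0} (hc : LipschitzWith A c) (hcQ : ∀ x, c x ∈ Q) {f : V → W} {m : V → ℝ}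
    (hf : ContDiff ℝ 1 f) (hm : ContDiff ℝ 1 m) :
    ∃ K C : ℝ≥0, LipschitzWith K (fun x => (max (m (c x)) 1)⁻¹ • f (c x)) ∧
      ∀ x, ‖(max (m (c x)) 1)⁻¹ • f (c x)‖ ≤ C := by
  obtain ⟨M, hM⟩ := hm.contDiffOn.exists_lipschitzOnWith one_ne_zero hQc hQ
  obtain ⟨B, hB⟩ := hQ.exists_bound_of_continuousOn hm.continuous.continuousOn
  have hR : IsCompact (Q ×ˢ Set.Icc 1 (max B 1)) := hQ.prod isCompact_Icc
  have hG : ContDiffOn ℝ 1 (fun p : V × ℝ => p.2⁻¹ • f p.1) (Q ×ˢ Set.Icc 1 (max B 1)) :=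
    (contDiffOn_snd.inv fun p hp => (zero_lt_one.trans_le hp.2.1).ne').smul
      (hf.comp contDiff_fst).contDiffOn
  obtain ⟨K, hK⟩ := hG.exists_lipschitzOnWith one_ne_zero (hQc.prod (convex_Icc _ _)) hR
  obtain ⟨C, hC⟩ := hR.exists_bound_of_continuousOn hG.continuousOn
  have hP : ∀ x, (c x, max (m (c x)) 1) ∈ Q ×ˢ Set.Icc 1 (max B 1) := fun x =>
    ⟨hcQ x, le_max_right _ _, max_le_max_right 1 ((le_abs_self _).trans (hB _ (hcQ x)))⟩
  have hmc : LipschitzWith (M * A) fun x => m (c x) :=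
    lipschitzOnWith_univ.1 (hM.comp hc.lipschitzOnWith fun x _ => hcQ x)
  have hPl : LipschitzWith (max A (M * A)) fun x => (c x, max (m (c x)) 1) :=
    hc.prodMk (hmc.max_const 1)
  exact ⟨K * max A (M * A), C.toNNReal,
    lipschitzOnWith_univ.1 (hK.comp hPl.lipschitzOnWith fun x _ => hP x),
    fun x => (hC _ (hP x)).trans (Real.le_coe_toNNReal C)⟩

variable (ℓ N : ℕ) (s : Finset ℕ)

theorem contDiff_truncMass : ContDiff ℝ 1 fun x : s → ℝ => truncMass ℓ N (extendZero s x) := by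
  unfold truncMass
  fun_prop

theorem contDiff_truncFlux :
    ContDiff ℝ 1 fun (x : s → ℝ) (n : s) => truncFlux ℓ N n (extendZero s x) := by
  unfold truncFlux truncGain truncLoss
  fun_prop

open scoped NNReal in
/-- Clamping the state to the unit cube and the normalising factor to `[1, ∞)` turns the
right-hand side into a bounded, globally Lipschitz vector field. -/
theorem exists_lipschitzWith_clamped :
    ∃ K C : ℝ≥0,
      LipschitzWith K (fun (x : s → ℝ) (n : s) =>
        truncFlux ℓ N n (extendZero s (clampUnit x)) /
          max (truncMass ℓ N (extendZero s (clampUnit x))) 1) ∧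
      ∀ x : s → ℝ, ‖fun n : s => truncFlux ℓ N n (extendZero s (clampUnit x)) /
          max (truncMass ℓ N (extendZero s (clampUnit x))) 1‖ ≤ C := by
  obtain ⟨K, C, hK, hC⟩ := exists_lipschitzWith_smul_comp
    (isCompact_Icc (a := (0 : s → ℝ)) (b := 1))
    (convex_Icc 0 1) lipschitzWith_clampUnit
    (fun x => ⟨fun i => clampUnit_nonneg x i, fun i => clampUnit_le_one x i⟩)
    (contDiff_truncFlux ℓ N s) (contDiff_truncMass ℓ N s)
  have e : ∀ x : s → ℝ, (max (truncMass ℓ N (extendZero s (clampUnit x))) 1)⁻¹ •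
      (fun n : s => truncFlux ℓ N n (extendZero s (clampUnit x))) =
      fun n : s => truncFlux ℓ N n (extendZero s (clampUnit x)) /
          max (truncMass ℓ N (extendZero s (clampUnit x))) 1 := fun x =>
    funext fun n => by rw [Pi.smul_apply, smul_eq_mul, div_eq_inv_mul]
  simp_rw [e] at hK hC
  exact ⟨K, C, hK, hC⟩

end VectorField

/-- Solutions of the truncated system with clamped state and clamped normalising factor. -/
theorem exists_clamped_solution (ℓ N : ℕ) (u0 : ℕ → ℝ) {T : ℝ} (hT : 0 ≤ T) :
    ∃ u : ℕ → ℝ → ℝ, ∀ n ∈ Finset.Icc (ℓ + 1) N, u n 0 = u0 n ∧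
      ∀ t ∈ Set.Icc 0 T, HasDerivWithinAt (u n)
        (truncFlux ℓ N n (clampUnit fun k => u k t) /
          max (truncMass ℓ N (clampUnit fun k => u k t)) 1) (Set.Icc 0 T) t := by
  obtain ⟨K, C, hK, hC⟩ := exists_lipschitzWith_clamped ℓ N (Finset.Icc (ℓ + 1) N)
  obtain ⟨α, hα0, hα⟩ :=
    exists_solution_of_lipschitzWith_of_bounded hK hC (fun n => u0 n) hT
  refine ⟨fun n t => extendZero _ (α t) n, fun n hn => ⟨?_, fun t ht => ?_⟩⟩
  · simp [extendZero_of_mem _ hn, hα0]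
  · simp only [extendZero_of_mem _ hn]
    have := hasDerivWithinAt_pi.1 (hα t ht) ⟨n, hn⟩
    rwa [extendZero_clampUnit] at this

/-- Existence of a nonnegative solution of the truncated system whose normalising factor is at
least one. -/
theorem exists_truncSolution {ℓ L N : ℕ} (hL : ℓ + 1 ≤ L)
    (hN : 2 * L + ℓ ≤ N) {u0 : ℕ → ℝ} (h0 : ∀ i, 0 ≤ u0 i)
    (hbdd : ∀ i, L < i → u0 i = 0)
    (hsum : ∑ i ∈ Finset.Icc (ℓ + 1) L, u0 i = 1) {T : ℝ} (hT : 0 < T)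
    (hTle : T ≤ ℓ / (2 * (ℓ + 1))) :
    ∃ u : ℕ → ℝ → ℝ, IsTruncSolution ℓ N T u0 u ∧
      (∀ n ∈ Finset.Icc (ℓ + 1) N, ∀ t ∈ Set.Icc 0 T, 0 ≤ u n t) ∧
      ∀ t ∈ Set.Icc 0 T, 1 ≤ MNfun ℓ N u t := by
  obtain ⟨u, hu⟩ := exists_clamped_solution ℓ N u0 hT.le
  have hN1 : 1 ≤ N := by omega
  have hcl : ∀ t n, 0 ≤ clampUnit (fun k => u k t) n := fun t n => clampUnit_nonneg _ n
  have hmax : ∀ t, 0 < max (truncMass ℓ N (clampUnit fun k => u k t)) 1 := fun t =>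
    zero_lt_one.trans_le (le_max_right _ _)
  have hnn : ∀ n ∈ Finset.Icc (ℓ + 1) N, ∀ t ∈ Set.Icc 0 T, 0 ≤ u n t := by
    intro n hn
    refine nonneg_of_deriv_nonneg_of_neg (hu n hn).2 ((hu n hn).1 ▸ h0 n) fun t _ hneg => ?_
    refine div_nonneg ?_ (hmax t).le
    have : truncLoss ℓ N n (clampUnit fun k => u k t) = 0 := by
      rw [truncLoss, clampUnit_of_nonpos (w := fun k => u k t) hneg.le]
      ring
    rw [truncFlux, this, mul_zero, sub_zero]
    exact truncGain_nonneg (hcl t) n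
  have hsumN : ∑ i ∈ Finset.Icc (ℓ + 1) N, u0 i = 1 := by
    rw [← hsum]
    refine (Finset.sum_subset (Finset.Icc_subset_Icc_right (by omega)) fun n hn hn' => ?_).symm
    simp only [Finset.mem_Icc] at hn hn'
    exact hbdd n (by omega)
  have hle : ∀ t ∈ Set.Icc 0 T, ∑ n ∈ Finset.Icc (ℓ + 1) N, u n t ≤ 1 := by
    intro t ht
    have := le_add_mul_of_deriv_le (c := 0)
      (fun t ht => HasDerivWithinAt.fun_sum fun n hn => (hu n hn).2 t ht)
      (fun t _ => by
        rw [← Finset.sum_div, sum_truncFlux hN1]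
        exact div_nonpos_of_nonpos_of_nonneg (neg_nonpos.2 (truncMass_nonneg (hcl t)))
          (hmax t).le) t ht
    rw [Finset.sum_congr rfl fun n hn => (hu n hn).1, hsumN] at this
    linarith
  have hclamp : ∀ t ∈ Set.Icc 0 T, ∀ n ∈ Finset.Icc (ℓ + 1) N,
      clampUnit (fun k => u k t) n = u n t := fun t ht n hn =>
    clampUnit_of_mem (hnn n hn t ht)
      ((Finset.single_le_sum (fun k hk => hnn k hk t ht) hn).trans (hle t ht))
  have hLN : ∀ n ∈ Finset.Icc (ℓ + 1) L, n ∈ Finset.Icc (ℓ + 1) N := fun n hn =>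
    Finset.Icc_subset_Icc_right (by omega) hn
  have hlow : ∀ t ∈ Set.Icc 0 T, 1 - 2 * t ≤ ∑ n ∈ Finset.Icc (ℓ + 1) L, u n t := by
    intro t ht
    have := add_mul_le_of_le_deriv (c := -2)
      (fun t ht => HasDerivWithinAt.fun_sum fun n hn => (hu n (hLN n hn)).2 t ht)
      (fun t _ => by
        rw [← Finset.sum_div, le_div_iff₀ (hmax t)]
        have h1 := neg_two_mul_truncMass_le_sum_truncFlux (ℓ := ℓ) (L := L) hN1 (by omega) (hcl t)
        have h2 := le_max_left (truncMass ℓ N (clampUnit fun k => u k t)) 1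
        linarith) t ht
    rw [Finset.sum_congr rfl fun n hn => (hu n (hLN n hn)).1, hsum] at this
    linarith
  have hmass : ∀ t ∈ Set.Icc 0 T, 1 ≤ truncMass ℓ N (clampUnit fun k => u k t) := by
    intro t ht
    refine le_trans ?_ (sq_sum_le_truncMass hL (by omega) (hcl t))
    rw [Finset.sum_congr rfl fun n hn => hclamp t ht n (hLN n hn)]
    refine one_le_pow₀ ?_
    have hpos : (0 : ℝ) < ℓ + 1 := by positivity
    have h1 : ((ℓ : ℝ) + 1) * (1 - 2 * t) ≤ (ℓ + 1) * ∑ n ∈ Finset.Icc (ℓ + 1) L, u n t :=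
      mul_le_mul_of_nonneg_left (hlow t ht) hpos.le
    have h2 := ht.2.trans hTle
    rw [le_div_iff₀ (by positivity)] at h2
    linarith
  have hmass' : ∀ t ∈ Set.Icc 0 T, truncMass ℓ N (clampUnit fun k => u k t) = MNfun ℓ N u t :=
    fun t ht => truncMass_congr (hclamp t ht)
  have hode : ∀ n ∈ Finset.Icc (ℓ + 1) N, ∀ t ∈ Set.Icc 0 T,
      HasDerivWithinAt (u n) (truncRHS ℓ N u n t) (Set.Icc 0 T) t := by
    intro n hn t ht
    have := (hu n hn).2 t ht
    rwa [max_eq_left (hmass t ht), truncFlux_congr hn (hclamp t ht), hmass' t ht,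
      MNfun_eq_truncMass, ← truncRHS_eq hn] at this
  have hM : ∀ t ∈ Set.Icc 0 T, 1 ≤ MNfun ℓ N u t := fun t ht => hmass' t ht ▸ hmass t ht
  refine ⟨u, ⟨fun n hn => ?_, fun n hn => (hu n hn).1, hode⟩, hnn, hM⟩
  have hud := uniqueDiffOn_Icc hT
  rw [contDiffOn_one_iff_derivWithin hud]
  refine ⟨fun t ht => (hode n hn t ht).differentiableWithinAt, ?_⟩
  have hcont : ContinuousOn (fun t (k : Finset.Icc (ℓ + 1) N) => u k t) (Set.Icc 0 T) :=
    continuousOn_pi.2 fun k t ht => (hode k k.2 t ht).continuousWithinAt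
  have hF := (continuous_pi_iff.1 (contDiff_truncFlux ℓ N _).continuous ⟨n, hn⟩).comp_continuousOn
    hcont
  have hm := (contDiff_truncMass ℓ N _).continuous.comp_continuousOn hcont
  have hext : ∀ t, ∀ k ∈ Finset.Icc (ℓ + 1) N,
      extendZero (Finset.Icc (ℓ + 1) N) (fun k => u k t) k = u k t := fun t k hk =>
    extendZero_of_mem _ hk
  have hmeq : ∀ t, truncMass ℓ N (extendZero (Finset.Icc (ℓ + 1) N) fun k => u k t) =
      truncMass ℓ N (fun k => u k t) := fun t => truncMass_congr (hext t)
  refine (hF.div hm fun t ht => ?_).congr fun t ht => ?_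
  · have := hM t ht
    rw [MNfun_eq_truncMass] at this
    simp only [Function.comp, hmeq]
    linarith
  · rw [(hode n hn t ht).derivWithin (hud t ht), truncRHS_eq hn]
    simp only [Function.comp, Pi.div_apply, hmeq, truncFlux_congr hn (hext t)]

/-- A solution of the truncated system with positive normalising factor is unique. -/
theorem IsTruncSolution.eqOn {ℓ N : ℕ} {T : ℝ} {u0 : ℕ → ℝ} {u v : ℕ → ℝ → ℝ}
    (hu : IsTruncSolution ℓ N T u0 u) (hv : IsTruncSolution ℓ N T u0 v)
    (hM : ∀ t ∈ Set.Icc 0 T, 0 < MNfun ℓ N u t) {n : ℕ} (hn : n ∈ Finset.Icc (ℓ + 1) N) :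
    Set.EqOn (v n) (u n) (Set.Icc 0 T) := by
  let s := Finset.Icc (ℓ + 1) N
  let F : (s → ℝ) → s → ℝ := fun x n =>
    truncFlux ℓ N n (extendZero s x) / truncMass ℓ N (extendZero s x)
  have hext : ∀ (w : ℕ → ℝ → ℝ) (t : ℝ), ∀ k ∈ Finset.Icc (ℓ + 1) N,
      extendZero s (fun k => w k t) k = w k t := fun w t k hk => extendZero_of_mem _ hk
  have hsol : ∀ {w : ℕ → ℝ → ℝ}, IsTruncSolution ℓ N T u0 w → ∀ t ∈ Set.Icc 0 T,
      HasDerivWithinAt (fun t (k : s) => w k t) (F fun k => w k t) (Set.Icc 0 T) t := by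
    intro w hw t ht
    refine hasDerivWithinAt_pi.2 fun k => ?_
    have := hw.ode k k.2 t ht
    rwa [truncRHS_eq k.2, ← truncMass_congr (hext w t), ← truncFlux_congr k.2 (hext w t)] at this
  have key := eqOn_of_contDiffAt_along (hsol hu) (hsol hv)
    (funext fun k => (hv.init k k.2).trans (hu.init k k.2).symm) fun t ht => by
      refine contDiffAt_pi.2 fun k => ContDiffAt.div ?_ (contDiff_truncMass ℓ N s).contDiffAt ?_
      · exact (contDiff_pi.1 (contDiff_truncFlux ℓ N s) k).contDiffAt
      · rw [truncMass_congr (hext u t)]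
        exact (hM t ht).ne'
  exact fun t ht => congrFun (key ht) ⟨n, hn⟩

/-- The zeroth and first moments of a solution are affine in time. -/
theorem IsTruncSolution.moments {ℓ N : ℕ} {T : ℝ} {u0 : ℕ → ℝ} {u : ℕ → ℝ → ℝ} (hN : 1 ≤ N)
    (hu : IsTruncSolution ℓ N T u0 u) (hM : ∀ t ∈ Set.Icc 0 T, 0 < MNfun ℓ N u t) {t : ℝ}
    (ht : t ∈ Set.Icc 0 T) :
    ∑ n ∈ Finset.Icc (ℓ + 1) N, u n t = ∑ n ∈ Finset.Icc (ℓ + 1) N, u n 0 - t ∧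
      ∑ n ∈ Finset.Icc (ℓ + 1) N, (n : ℝ) * u n t =
        ∑ n ∈ Finset.Icc (ℓ + 1) N, (n : ℝ) * u n 0 - ℓ * t := by
  have affine : ∀ (φ : ℕ → ℝ) (c : ℝ),
      (∀ w : ℕ → ℝ, ∑ n ∈ Finset.Icc (ℓ + 1) N, φ n * truncFlux ℓ N n w =
        c * truncMass ℓ N w) →
      ∑ n ∈ Finset.Icc (ℓ + 1) N, φ n * u n t =
        ∑ n ∈ Finset.Icc (ℓ + 1) N, φ n * u n 0 + c * t := by
    intro φ c hφ
    have hd : ∀ t ∈ Set.Icc 0 T, HasDerivWithinAt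
        (fun t => ∑ n ∈ Finset.Icc (ℓ + 1) N, φ n * u n t) c (Set.Icc 0 T) t := by
      intro t ht
      have h := HasDerivWithinAt.fun_sum fun n (hn : n ∈ Finset.Icc (ℓ + 1) N) =>
        (hu.ode n hn t ht).const_mul (φ n)
      refine h.congr_deriv ?_
      have hMt := (hM t ht).ne'
      rw [MNfun_eq_truncMass] at hMt
      have hR : ∀ n ∈ Finset.Icc (ℓ + 1) N, φ n * truncRHS ℓ N u n t =
          φ n * truncFlux ℓ N n (fun n => u n t) / truncMass ℓ N (fun n => u n t) :=
        fun n hn => by rw [truncRHS_eq hn, mul_div_assoc]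
      rw [Finset.sum_congr rfl hR, ← Finset.sum_div, hφ, mul_div_cancel_right₀ _ hMt]
    exact le_antisymm (le_add_mul_of_deriv_le hd (fun _ _ => le_rfl) t ht)
      (add_mul_le_of_le_deriv hd (fun _ _ => le_rfl) t ht)
  constructor
  · have := affine (fun _ => 1) (-1) fun w => by simpa using sum_truncFlux hN w
    simpa [sub_eq_add_neg] using this
  · have := affine (fun n => n) (-ℓ) fun w => by simpa using sum_mul_truncFlux hN w
    simpa [sub_eq_add_neg] using this

/-- for `ℓ ≥ 1`, `L ≥ ℓ+1`, `N ≥ 2L+ℓ` and bounded large initial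
data, the truncated system has a unique solution on `[0,T₁]` with
`T₁ = ℓ/(2(ℓ+1))`; it is nonnegative and satisfies `m₀^(N)(t) = 1 − t`,
`m₁^(N)(t) = m₁^(N)(0) − ℓ t` and `M^(N)(t) ≥ 1` on `[0,T₁]`. -/
theorem truncated_system_wellposed (ℓ L N : ℕ) (hℓ : 1 ≤ ℓ) (hL : ℓ + 1 ≤ L)
    (hN : 2 * L + ℓ ≤ N) (u0 : ℕ → ℝ) (h0 : ∀ i, 0 ≤ u0 i)
    (hbdd : ∀ i, L < i → u0 i = 0)
    (hsum : ∑ i ∈ Finset.Icc (ℓ + 1) L, u0 i = 1) :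
    ∃ u : ℕ → ℝ → ℝ,
      IsTruncSolution ℓ N (ℓ / (2 * (ℓ + 1)) : ℝ) u0 u ∧
      -- uniqueness
      (∀ v : ℕ → ℝ → ℝ, IsTruncSolution ℓ N (ℓ / (2 * (ℓ + 1)) : ℝ) u0 v →
        ∀ n ∈ Finset.Icc (ℓ + 1) N,
          Set.EqOn (v n) (u n) (Set.Icc 0 (ℓ / (2 * (ℓ + 1)) : ℝ))) ∧
      -- nonnegativity
      (∀ n ∈ Finset.Icc (ℓ + 1) N,
        ∀ t ∈ Set.Icc (0 : ℝ) (ℓ / (2 * (ℓ + 1)) : ℝ), 0 ≤ u n t) ∧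
      -- m₀^(N)(t) = 1 − t
      (∀ t ∈ Set.Icc (0 : ℝ) (ℓ / (2 * (ℓ + 1)) : ℝ),
        ∑ n ∈ Finset.Icc (ℓ + 1) N, u n t = 1 - t) ∧
      -- m₁^(N)(t) = m₁^(N)(0) − ℓ t
      (∀ t ∈ Set.Icc (0 : ℝ) (ℓ / (2 * (ℓ + 1)) : ℝ),
        ∑ n ∈ Finset.Icc (ℓ + 1) N, (n : ℝ) * u n t =
          (∑ n ∈ Finset.Icc (ℓ + 1) N, (n : ℝ) * u n 0) - (ℓ : ℝ) * t) ∧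
      -- M^(N)(t) ≥ 1
      (∀ t ∈ Set.Icc (0 : ℝ) (ℓ / (2 * (ℓ + 1)) : ℝ), 1 ≤ MNfun ℓ N u t) := by
  have hℓ' : (0 : ℝ) < ℓ := by exact_mod_cast hℓ
  obtain ⟨u, hu, hnn, hM⟩ := exists_truncSolution hL hN h0 hbdd hsum
    (T := (ℓ / (2 * (ℓ + 1)) : ℝ)) (by positivity) le_rfl
  have hM' : ∀ t ∈ Set.Icc (0 : ℝ) (ℓ / (2 * (ℓ + 1)) : ℝ), 0 < MNfun ℓ N u t := fun t ht =>
    zero_lt_one.trans_le (hM t ht)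
  have hinit : ∑ n ∈ Finset.Icc (ℓ + 1) N, u n 0 = 1 := by
    rw [Finset.sum_congr rfl fun n hn => hu.init n hn, ← hsum]
    refine (Finset.sum_subset (Finset.Icc_subset_Icc_right (by omega)) fun n hn hn' => ?_).symm
    simp only [Finset.mem_Icc] at hn hn'
    exact hbdd n (by omega)
  exact ⟨u, hu, fun v hv n hn => hu.eqOn hv hM' hn, hnn,
    fun t ht => hinit ▸ (hu.moments (by omega) hM' ht).1,
    fun t ht => (hu.moments (by omega) hM' ht).2, hM⟩
end
end
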